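/- arXiv:1302.3271 — 3 statements merged into one kernel-verified Lean document; each statement's English description precedes it below -/
import Mathlib

section
/- Let F be a generalized isotropic Berwald metric with data (μ, λ) whose stretch curvature vanishes (Σ_{ijkl} = 0). Then ( μ' − (1/2) μ² F ) C_{ijk} = 0 at every point of U × (ℝ^n ∖ {0}), where μ' := μ_{|s} y^s. -/
/-!  Common setup: Finsler metrics on an open set `U ⊆ ℝⁿ`, in coordinates. -/

noncomputable section

open scoped BigOperators

/-- Points/vectors of `ℝⁿ`, as functions `Fin n → ℝ`. -/
abbrev Pt (n : ℕ) := Fin n → ℝ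

variable {n : ℕ}

/-- Partial derivative in the fiber variable `y`, direction `yⁱ`. -/
def pdy (f : Pt n → Pt n → ℝ) (i : Fin n) : Pt n → Pt n → ℝ :=
  fun x y => fderiv ℝ (fun y' => f x y') y (Pi.single i 1)

/-- Partial derivative in the base variable `x`, direction `xⁱ`. -/
def pdx (f : Pt n → Pt n → ℝ) (i : Fin n) : Pt n → Pt n → ℝ :=
  fun x y => fderiv ℝ (fun x' => f x' y) x (Pi.single i 1)

/-- `F²`. -/
def F2 (F : Pt n → Pt n → ℝ) : Pt n → Pt n → ℝ := fun x y => (F x y) ^ 2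

/-- Fundamental tensor `g_{ij} = (1/2) ∂²(F²)/∂yⁱ∂yʲ`. -/
def gLow (F : Pt n → Pt n → ℝ) (i j : Fin n) : Pt n → Pt n → ℝ :=
  fun x y => (1 / 2 : ℝ) * pdy (pdy (F2 F) j) i x y

/-- The fundamental tensor as a matrix. -/
def gMat (F : Pt n → Pt n → ℝ) (x y : Pt n) : Matrix (Fin n) (Fin n) ℝ :=
  Matrix.of fun i j => gLow F i j x y

/-- Inverse fundamental tensor `g^{ij}`. -/
def gInv (F : Pt n → Pt n → ℝ) (i j : Fin n) : Pt n → Pt n → ℝ :=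
  fun x y => (gMat F x y)⁻¹ i j

/-- Lowered fiber variable `y_i := g_{ij} yʲ`. -/
def yLow (F : Pt n → Pt n → ℝ) (i : Fin n) : Pt n → Pt n → ℝ :=
  fun x y => ∑ j, gLow F i j x y * y j

/-- `ℓⁱ := yⁱ / F`. -/
def ell (F : Pt n → Pt n → ℝ) (i : Fin n) : Pt n → Pt n → ℝ :=
  fun x y => y i / F x y

/-- Angular metric `h_{ij} := g_{ij} - F⁻² y_i y_j`. -/
def hLow (F : Pt n → Pt n → ℝ) (i j : Fin n) : Pt n → Pt n → ℝ :=
  fun x y => gLow F i j x y - yLow F i x y * yLow F j x y / (F x y) ^ 2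

/-- `hⁱ_j := δⁱ_j - F⁻² yⁱ y_j`. -/
def hUp (F : Pt n → Pt n → ℝ) (i j : Fin n) : Pt n → Pt n → ℝ :=
  fun x y => (if i = j then (1 : ℝ) else 0) - y i * yLow F j x y / (F x y) ^ 2

/-- Cartan torsion `C_{ijk} := (1/4) ∂³(F²)/∂yⁱ∂yʲ∂yᵏ`. -/
def Cartan (F : Pt n → Pt n → ℝ) (i j k : Fin n) : Pt n → Pt n → ℝ :=
  fun x y => (1 / 4 : ℝ) * pdy (pdy (pdy (F2 F) k) j) i x y

/-- Mean Cartan torsion `I_k := g^{ij} C_{ijk}`. -/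
def mCartan (F : Pt n → Pt n → ℝ) (k : Fin n) : Pt n → Pt n → ℝ :=
  fun x y => ∑ i, ∑ j, gInv F i j x y * Cartan F i j k x y

/-- Spray coefficients `Gⁱ`. -/
def Gspray (F : Pt n → Pt n → ℝ) (i : Fin n) : Pt n → Pt n → ℝ :=
  fun x y => (1 / 4 : ℝ) * ∑ l, gInv F i l x y *
    ((∑ k, y k * pdx (pdy (F2 F) l) k x y) - pdx (F2 F) l x y)

/-- Berwald curvature `Bⁱ_{jkl} := ∂³Gⁱ/∂yʲ∂yᵏ∂yˡ`. -/
def Bcurv (F : Pt n → Pt n → ℝ) (i j k l : Fin n) : Pt n → Pt n → ℝ :=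
  pdy (pdy (pdy (Gspray F i) l) k) j

/-- Mean Berwald curvature `E_{jk} := (1/2) Bᵐ_{jkm}`. -/
def Ecurv (F : Pt n → Pt n → ℝ) (j k : Fin n) : Pt n → Pt n → ℝ :=
  fun x y => (1 / 2 : ℝ) * ∑ m, Bcurv F m j k m x y

/-- Nonlinear connection `Nⁱ_j := ∂Gⁱ/∂yʲ`. -/
def Ncon (F : Pt n → Pt n → ℝ) (i j : Fin n) : Pt n → Pt n → ℝ :=
  pdy (Gspray F i) j

/-- Berwald connection coefficients `Γⁱ_{jk} := ∂²Gⁱ/∂yʲ∂yᵏ`. -/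
def Γcon (F : Pt n → Pt n → ℝ) (i j k : Fin n) : Pt n → Pt n → ℝ :=
  pdy (pdy (Gspray F i) k) j

/-- Horizontal (Berwald) covariant derivative of a scalar. -/
def hD0 (F : Pt n → Pt n → ℝ) (f : Pt n → Pt n → ℝ) (m : Fin n) : Pt n → Pt n → ℝ :=
  fun x y => pdx f m x y - ∑ r, Ncon F r m x y * pdy f r x y

/-- Horizontal covariant derivative of a covariant 2-tensor. -/
def hD2 (F : Pt n → Pt n → ℝ) (T : Fin n → Fin n → Pt n → Pt n → ℝ) (j k m : Fin n) :
    Pt n → Pt n → ℝ :=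
  fun x y => hD0 F (T j k) m x y - (∑ r, T r k x y * Γcon F r j m x y)
    - ∑ r, T j r x y * Γcon F r k m x y

/-- Horizontal covariant derivative of a covariant 3-tensor. -/
def hD3 (F : Pt n → Pt n → ℝ) (T : Fin n → Fin n → Fin n → Pt n → Pt n → ℝ) (i j k m : Fin n) :
    Pt n → Pt n → ℝ :=
  fun x y => hD0 F (T i j k) m x y - (∑ r, T r j k x y * Γcon F r i m x y)
    - (∑ r, T i r k x y * Γcon F r j m x y) - ∑ r, T i j r x y * Γcon F r k m x y

/-- Horizontal covariant derivative of a (1,3)-tensor `Tⁱ_{jkl}`. -/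
def hD13 (F : Pt n → Pt n → ℝ) (T : Fin n → Fin n → Fin n → Fin n → Pt n → Pt n → ℝ)
    (i j k l m : Fin n) : Pt n → Pt n → ℝ :=
  fun x y => hD0 F (T i j k l) m x y + (∑ r, T r j k l x y * Γcon F i r m x y)
    - (∑ r, T i r k l x y * Γcon F r j m x y) - (∑ r, T i j r l x y * Γcon F r k m x y)
    - ∑ r, T i j k r x y * Γcon F r l m x y

/-- Landsberg curvature `L_{ijk} := C_{ijk|m} yᵐ`. -/
def Land (F : Pt n → Pt n → ℝ) (i j k : Fin n) : Pt n → Pt n → ℝ :=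
  fun x y => ∑ m, hD3 F (Cartan F) i j k m x y * y m

/-- Stretch curvature `Σ_{ijkl} := 2(L_{ijk|l} - L_{ijl|k})`. -/
def Stretch (F : Pt n → Pt n → ℝ) (i j k l : Fin n) : Pt n → Pt n → ℝ :=
  fun x y => 2 * (hD3 F (Land F) i j k l x y - hD3 F (Land F) i j l k x y)

/-- Douglas tensor `Dⁱ_{jkl}`. -/
def Douglas (F : Pt n → Pt n → ℝ) (i j k l : Fin n) : Pt n → Pt n → ℝ :=
  fun x y => Bcurv F i j k l x y - (2 / ((n : ℝ) + 1)) *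
    (Ecurv F j k x y * (if i = l then (1 : ℝ) else 0)
      + Ecurv F j l x y * (if i = k then (1 : ℝ) else 0)
      + Ecurv F k l x y * (if i = j then (1 : ℝ) else 0)
      + pdy (Ecurv F j k) l x y * y i)

/-- Riemann curvature `Rⁱ_k`. -/
def RiemK (F : Pt n → Pt n → ℝ) (i k : Fin n) : Pt n → Pt n → ℝ :=
  fun x y => 2 * pdx (Gspray F i) k x y - (∑ j, y j * pdx (pdy (Gspray F i) k) j x y)
    + 2 * (∑ j, Gspray F j x y * Γcon F i j k x y) - ∑ j, Ncon F i j x y * Ncon F j k x y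

/-- `Rⁱ_{jkl} := (1/3) ∂/∂yʲ (∂Rⁱ_k/∂yˡ - ∂Rⁱ_l/∂yᵏ)`. -/
def Riem4 (F : Pt n → Pt n → ℝ) (i j k l : Fin n) : Pt n → Pt n → ℝ :=
  fun x y => (1 / 3 : ℝ) *
    pdy (fun x' y' => pdy (RiemK F i k) l x' y' - pdy (RiemK F i l) k x' y') j x y

/-- `F` is R-quadratic on `U`: `Rⁱ_{jkl}(x,y)` is independent of `y`. -/
def RQuadratic (U : Set (Pt n)) (F : Pt n → Pt n → ℝ) : Prop :=
  ∀ x ∈ U, ∀ y y' : Pt n, y ≠ 0 → y' ≠ 0 →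
    ∀ i j k l, Riem4 F i j k l x y = Riem4 F i j k l x y'

/-- A Finsler metric on a connected open set `U ⊆ ℝⁿ` (`n ≥ 2`). -/
structure IsFinslerMetric (U : Set (Pt n)) (F : Pt n → Pt n → ℝ) : Prop where
  dim : 2 ≤ n
  isOpen : IsOpen U
  connected : IsConnected U
  smooth : ContDiffOn ℝ (⊤ : ℕ∞) (Function.uncurry F) (U ×ˢ {y : Pt n | y ≠ 0})
  pos : ∀ x ∈ U, ∀ y : Pt n, y ≠ 0 → 0 < F x y
  homog : ∀ x ∈ U, ∀ y : Pt n, y ≠ 0 → ∀ t : ℝ, 0 < t → F x (t • y) = t * F x y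
  posdef : ∀ x ∈ U, ∀ y : Pt n, y ≠ 0 → (gMat F x y).PosDef

/-- `F` is a generalized isotropic Berwald metric on `U` with data `(μ, λ)`. -/
structure IsGIB (U : Set (Pt n)) (F μ lam : Pt n → Pt n → ℝ) : Prop where
  finsler : IsFinslerMetric U F
  smooth_mu : ContDiffOn ℝ (⊤ : ℕ∞) (Function.uncurry μ) (U ×ˢ {y : Pt n | y ≠ 0})
  smooth_lam : ContDiffOn ℝ (⊤ : ℕ∞) (Function.uncurry lam) (U ×ˢ {y : Pt n | y ≠ 0})
  homog_mu : ∀ x ∈ U, ∀ y : Pt n, y ≠ 0 → ∀ t : ℝ, 0 < t → μ x (t • y) = μ x y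
  homog_lam : ∀ x ∈ U, ∀ y : Pt n, y ≠ 0 → ∀ t : ℝ, 0 < t → lam x (t • y) = t⁻¹ * lam x y
  berwald : ∀ x ∈ U, ∀ y : Pt n, y ≠ 0 → ∀ i j k l,
    Bcurv F i j k l x y = μ x y * Cartan F j k l x y * ell F i x y
      + lam x y * (hUp F i j x y * hLow F k l x y + hUp F i k x y * hLow F j l x y
        + hUp F i l x y * hLow F j k x y)

end

section SmoothCalculus

variable {n : ℕ}

/-- Smoothness on the slit tangent bundle of `U`. -/
def SmoothSlit (U : Set (Pt n)) (f : Pt n → Pt n → ℝ) : Prop :=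
  ContDiffOn ℝ (⊤ : ℕ∞) (Function.uncurry f) (U ×ˢ {y : Pt n | y ≠ 0})

/-- Equality on the slit tangent bundle of `U`. -/
def EqSlit (U : Set (Pt n)) (f g : Pt n → Pt n → ℝ) : Prop :=
  ∀ x ∈ U, ∀ y : Pt n, y ≠ 0 → f x y = g x y

/-- Positive homogeneity of integer degree in the fiber variable. -/
def HomogSlit (U : Set (Pt n)) (k : ℤ) (f : Pt n → Pt n → ℝ) : Prop :=
  ∀ x ∈ U, ∀ y : Pt n, y ≠ 0 → ∀ t : ℝ, 0 < t → f x (t • y) = t ^ k * f x y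

variable {U : Set (Pt n)} {f g : Pt n → Pt n → ℝ}

theorem isOpen_slit (hU : IsOpen U) : IsOpen (U ×ˢ {y : Pt n | y ≠ 0}) :=
  hU.prod isOpen_ne

theorem EqSlit.trans {k : Pt n → Pt n → ℝ} (h : EqSlit U f g) (h' : EqSlit U g k) :
    EqSlit U f k :=
  fun x hx y hy => (h x hx y hy).trans (h' x hx y hy)

theorem SmoothSlit.congr (hf : SmoothSlit U f) (h : EqSlit U g f) : SmoothSlit U g :=
  ContDiffOn.congr hf fun p hp => h p.1 hp.1 p.2 hp.2

theorem EqSlit.pdy (h : EqSlit U f g) (i : Fin n) : EqSlit U (pdy f i) (pdy g i) := by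
  intro x hx y hy
  have : (fun y' => f x y') =ᶠ[nhds y] fun y' => g x y' := by
    filter_upwards [isOpen_ne.mem_nhds hy] with z hz using h x hx z hz
  simp only [_root_.pdy, this.fderiv_eq]

theorem EqSlit.pdx (hU : IsOpen U) (h : EqSlit U f g) (i : Fin n) :
    EqSlit U (pdx f i) (pdx g i) := by
  intro x hx y hy
  have : (fun x' => f x' y) =ᶠ[nhds x] fun x' => g x' y := by
    filter_upwards [hU.mem_nhds hx] with z hz using h z hz y hy
  simp only [_root_.pdx, this.fderiv_eq]

namespace SmoothSlit

theorem contDiffAt (hU : IsOpen U) (hf : SmoothSlit U f) {x y : Pt n} (hx : x ∈ U)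
    (hy : y ≠ 0) : ContDiffAt ℝ (⊤ : ℕ∞) (Function.uncurry f) (x, y) :=
  ContDiffOn.contDiffAt hf ((isOpen_slit hU).mem_nhds ⟨hx, hy⟩)

theorem differentiableAt (hU : IsOpen U) (hf : SmoothSlit U f) {x y : Pt n} (hx : x ∈ U)
    (hy : y ≠ 0) : DifferentiableAt ℝ (Function.uncurry f) (x, y) :=
  (hf.contDiffAt hU hx hy).differentiableAt (by simp)

theorem hasFDerivAt_snd (hU : IsOpen U) (hf : SmoothSlit U f) {x y : Pt n} (hx : x ∈ U)
    (hy : y ≠ 0) : HasFDerivAt (fun y' => f x y')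
      ((fderiv ℝ (Function.uncurry f) (x, y)).comp (ContinuousLinearMap.inr ℝ _ _)) y :=
  (hf.differentiableAt hU hx hy).hasFDerivAt.comp y (hasFDerivAt_prodMk_right x y)

theorem hasFDerivAt_fst (hU : IsOpen U) (hf : SmoothSlit U f) {x y : Pt n} (hx : x ∈ U)
    (hy : y ≠ 0) : HasFDerivAt (fun x' => f x' y)
      ((fderiv ℝ (Function.uncurry f) (x, y)).comp (ContinuousLinearMap.inl ℝ _ _)) x :=
  HasFDerivAt.comp (f := fun x' => (x', y)) x (hf.differentiableAt hU hx hy).hasFDerivAt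
    (hasFDerivAt_prodMk_left x y)

theorem pdy_eq (hU : IsOpen U) (hf : SmoothSlit U f) (i : Fin n) :
    EqSlit U (pdy f i)
      fun x y => fderiv ℝ (Function.uncurry f) (x, y) (0, Pi.single i 1) := by
  intro x hx y hy
  simp [_root_.pdy, (hf.hasFDerivAt_snd hU hx hy).fderiv]

theorem pdx_eq (hU : IsOpen U) (hf : SmoothSlit U f) (i : Fin n) :
    EqSlit U (pdx f i)
      fun x y => fderiv ℝ (Function.uncurry f) (x, y) (Pi.single i 1, 0) := by
  intro x hx y hy
  simp [_root_.pdx, (hf.hasFDerivAt_fst hU hx hy).fderiv]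

theorem fderiv_apply (hU : IsOpen U) (hf : SmoothSlit U f) (v : Pt n × Pt n) :
    SmoothSlit U fun x y => fderiv ℝ (Function.uncurry f) (x, y) v := by
  have h : ContDiffOn ℝ (⊤ : ℕ∞) (fderiv ℝ (Function.uncurry f)) (U ×ˢ {y : Pt n | y ≠ 0}) :=
    ContDiffOn.fderiv_of_isOpen hf (isOpen_slit hU) (by simp)
  exact h.clm_apply contDiffOn_const

theorem fderiv_apply_comm (hU : IsOpen U) (hf : SmoothSlit U f) (v w : Pt n × Pt n)
    {x y : Pt n} (hx : x ∈ U) (hy : y ≠ 0) :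
    fderiv ℝ (fun p => fderiv ℝ (Function.uncurry f) p v) (x, y) w
      = fderiv ℝ (fun p => fderiv ℝ (Function.uncurry f) p w) (x, y) v := by
  have hs : IsSymmSndFDerivAt ℝ (Function.uncurry f) (x, y) :=
    (hf.contDiffAt hU hx hy).isSymmSndFDerivAt <| by
      simp only [minSmoothness_of_isRCLikeNormedField]
      exact WithTop.coe_le_coe.mpr le_top
  have hd : DifferentiableAt ℝ (fderiv ℝ (Function.uncurry f)) (x, y) :=
    ((hf.contDiffAt hU hx hy).fderiv_right (m := 1) (WithTop.coe_le_coe.mpr le_top)).differentiableAt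
      (by simp)
  rw [fderiv_clm_apply hd (by fun_prop), fderiv_clm_apply hd (by fun_prop)]
  simpa using hs w v

theorem pdy (hU : IsOpen U) (hf : SmoothSlit U f) (i : Fin n) : SmoothSlit U (pdy f i) :=
  (hf.fderiv_apply hU _).congr (hf.pdy_eq hU i)

theorem pdx (hU : IsOpen U) (hf : SmoothSlit U f) (i : Fin n) : SmoothSlit U (pdx f i) :=
  (hf.fderiv_apply hU _).congr (hf.pdx_eq hU i)

theorem pdy_pdy_comm (hU : IsOpen U) (hf : SmoothSlit U f) (i j : Fin n) :
    EqSlit U (_root_.pdy (_root_.pdy f i) j) (_root_.pdy (_root_.pdy f j) i) := by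
  intro x hx y hy
  rw [(hf.pdy_eq hU i).pdy j x hx y hy, (hf.pdy_eq hU j).pdy i x hx y hy,
    (hf.fderiv_apply hU _).pdy_eq hU _ x hx y hy, (hf.fderiv_apply hU _).pdy_eq hU _ x hx y hy]
  exact hf.fderiv_apply_comm hU _ _ hx hy

theorem pdx_pdy_comm (hU : IsOpen U) (hf : SmoothSlit U f) (i j : Fin n) :
    EqSlit U (_root_.pdx (_root_.pdy f i) j) (_root_.pdy (_root_.pdx f j) i) := by
  intro x hx y hy
  rw [(hf.pdy_eq hU i).pdx hU j x hx y hy, (hf.pdx_eq hU j).pdy i x hx y hy,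
    (hf.fderiv_apply hU _).pdx_eq hU _ x hx y hy, (hf.fderiv_apply hU _).pdy_eq hU _ x hx y hy]
  exact hf.fderiv_apply_comm hU _ _ hx hy

theorem const (c : ℝ) : SmoothSlit U fun _ _ => c := contDiffOn_const

theorem coord (i : Fin n) : SmoothSlit U fun _ y => y i := by
  have h : ContDiff ℝ (⊤ : ℕ∞) fun p : Pt n × Pt n => p.2 i := by fun_prop
  exact h.contDiffOn

theorem mul (hf : SmoothSlit U f) (hg : SmoothSlit U g) :
    SmoothSlit U fun x y => f x y * g x y :=
  ContDiffOn.mul hf hg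

theorem add (hf : SmoothSlit U f) (hg : SmoothSlit U g) :
    SmoothSlit U fun x y => f x y + g x y :=
  ContDiffOn.add hf hg

theorem sub (hf : SmoothSlit U f) (hg : SmoothSlit U g) :
    SmoothSlit U fun x y => f x y - g x y :=
  ContDiffOn.sub hf hg

theorem inv (hf : SmoothSlit U f) (h : ∀ x ∈ U, ∀ y : Pt n, y ≠ 0 → f x y ≠ 0) :
    SmoothSlit U fun x y => (f x y)⁻¹ :=
  ContDiffOn.inv hf fun p hp => h p.1 hp.1 p.2 hp.2

theorem sum {ι : Type*} {s : Finset ι} {f : ι → Pt n → Pt n → ℝ}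
    (hf : ∀ r ∈ s, SmoothSlit U (f r)) : SmoothSlit U fun x y => ∑ r ∈ s, f r x y :=
  ContDiffOn.sum (f := fun r => Function.uncurry (f r)) hf

theorem prod {ι : Type*} {s : Finset ι} {f : ι → Pt n → Pt n → ℝ}
    (hf : ∀ r ∈ s, SmoothSlit U (f r)) : SmoothSlit U fun x y => ∏ r ∈ s, f r x y :=
  contDiffOn_prod (f := fun r => Function.uncurry (f r)) hf

theorem det {ι : Type*} [Fintype ι] [DecidableEq ι] {M : Pt n → Pt n → Matrix ι ι ℝ}
    (hM : ∀ i j, SmoothSlit U fun x y => M x y i j) : SmoothSlit U fun x y => (M x y).det := by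
  simp only [Matrix.det_apply']
  exact sum fun σ _ => (const _).mul (prod fun i _ => hM _ _)

theorem matrix_inv {ι : Type*} [Fintype ι] [DecidableEq ι] {M : Pt n → Pt n → Matrix ι ι ℝ}
    (hM : ∀ i j, SmoothSlit U fun x y => M x y i j)
    (h : ∀ x ∈ U, ∀ y : Pt n, y ≠ 0 → (M x y).det ≠ 0) (i j : ι) :
    SmoothSlit U fun x y => (M x y)⁻¹ i j := by
  simp only [Matrix.inv_def, Ring.inverse_eq_inv', Matrix.smul_apply, smul_eq_mul,
    Matrix.adjugate_apply]
  refine ((det hM).inv h).mul (det fun a b => ?_)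
  simp only [Matrix.updateRow_apply]
  split_ifs
  · exact const _
  · exact hM a b

theorem differentiableAt_snd (hU : IsOpen U) (hf : SmoothSlit U f) {x y : Pt n} (hx : x ∈ U)
    (hy : y ≠ 0) : DifferentiableAt ℝ (fun y' => f x y') y :=
  (hf.hasFDerivAt_snd hU hx hy).differentiableAt

theorem differentiableAt_fst (hU : IsOpen U) (hf : SmoothSlit U f) {x y : Pt n} (hx : x ∈ U)
    (hy : y ≠ 0) : DifferentiableAt ℝ (fun x' => f x' y) x :=
  (hf.hasFDerivAt_fst hU hx hy).differentiableAt

theorem pdy_mul (hU : IsOpen U) (hf : SmoothSlit U f) (hg : SmoothSlit U g) (i : Fin n) :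
    EqSlit U (_root_.pdy (fun x y => f x y * g x y) i)
      fun x y => _root_.pdy f i x y * g x y + f x y * _root_.pdy g i x y := by
  intro x hx y hy
  simp only [_root_.pdy]
  rw [fderiv_fun_mul (hf.differentiableAt_snd hU hx hy) (hg.differentiableAt_snd hU hx hy)]
  simp
  ring

theorem pdx_mul (hU : IsOpen U) (hf : SmoothSlit U f) (hg : SmoothSlit U g) (i : Fin n) :
    EqSlit U (_root_.pdx (fun x y => f x y * g x y) i)
      fun x y => _root_.pdx f i x y * g x y + f x y * _root_.pdx g i x y := by
  intro x hx y hy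
  simp only [_root_.pdx]
  rw [fderiv_fun_mul (hf.differentiableAt_fst hU hx hy) (hg.differentiableAt_fst hU hx hy)]
  simp
  ring

theorem pdy_add (hU : IsOpen U) (hf : SmoothSlit U f) (hg : SmoothSlit U g) (i : Fin n) :
    EqSlit U (_root_.pdy (fun x y => f x y + g x y) i)
      fun x y => _root_.pdy f i x y + _root_.pdy g i x y := by
  intro x hx y hy
  simp only [_root_.pdy]
  rw [fderiv_fun_add (hf.differentiableAt_snd hU hx hy) (hg.differentiableAt_snd hU hx hy)]
  simp

theorem pdy_sum (hU : IsOpen U) {ι : Type*} {s : Finset ι} {f : ι → Pt n → Pt n → ℝ}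
    (hf : ∀ r ∈ s, SmoothSlit U (f r)) (i : Fin n) :
    EqSlit U (_root_.pdy (fun x y => ∑ r ∈ s, f r x y) i)
      fun x y => ∑ r ∈ s, _root_.pdy (f r) i x y := by
  intro x hx y hy
  simp only [_root_.pdy]
  rw [fderiv_fun_sum fun r hr => (hf r hr).differentiableAt_snd hU hx hy]
  simp

theorem pdx_sum (hU : IsOpen U) {ι : Type*} {s : Finset ι} {f : ι → Pt n → Pt n → ℝ}
    (hf : ∀ r ∈ s, SmoothSlit U (f r)) (i : Fin n) :
    EqSlit U (_root_.pdx (fun x y => ∑ r ∈ s, f r x y) i)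
      fun x y => ∑ r ∈ s, _root_.pdx (f r) i x y := by
  intro x hx y hy
  simp only [_root_.pdx]
  rw [fderiv_fun_sum fun r hr => (hf r hr).differentiableAt_fst hU hx hy]
  simp

/-- Second-order Leibniz rule in the fiber variables. -/
theorem pdy_pdy_mul (hU : IsOpen U) (hf : SmoothSlit U f) (hg : SmoothSlit U g) (k j : Fin n) :
    EqSlit U (_root_.pdy (_root_.pdy (fun x y => f x y * g x y) k) j) fun x y =>
      (_root_.pdy (_root_.pdy f k) j x y * g x y + _root_.pdy f k x y * _root_.pdy g j x y)
      + (_root_.pdy f j x y * _root_.pdy g k x y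
        + f x y * _root_.pdy (_root_.pdy g k) j x y) := by
  intro x hx y hy
  simp only [(hf.pdy_mul hU hg k).pdy j x hx y hy,
    ((hf.pdy hU k).mul hg).pdy_add hU (hf.mul (hg.pdy hU k)) j x hx y hy,
    (hf.pdy hU k).pdy_mul hU hg j x hx y hy, hf.pdy_mul hU (hg.pdy hU k) j x hx y hy]

/-- Third-order Leibniz rule in the fiber variables. -/
theorem pdy_pdy_pdy_mul (hU : IsOpen U) (hf : SmoothSlit U f) (hg : SmoothSlit U g)
    (k j i : Fin n) :
    EqSlit U (_root_.pdy (_root_.pdy (_root_.pdy (fun x y => f x y * g x y) k) j) i) fun x y =>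
      _root_.pdy (_root_.pdy (_root_.pdy f k) j) i x y * g x y
      + _root_.pdy (_root_.pdy f k) j x y * _root_.pdy g i x y
      + _root_.pdy (_root_.pdy f k) i x y * _root_.pdy g j x y
      + _root_.pdy (_root_.pdy f j) i x y * _root_.pdy g k x y
      + _root_.pdy f k x y * _root_.pdy (_root_.pdy g j) i x y
      + _root_.pdy f j x y * _root_.pdy (_root_.pdy g k) i x y
      + _root_.pdy f i x y * _root_.pdy (_root_.pdy g k) j x y
      + f x y * _root_.pdy (_root_.pdy (_root_.pdy g k) j) i x y := by
  intro x hx y hy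
  have hfk := hf.pdy hU k
  have hfj := hf.pdy hU j
  have hgk := hg.pdy hU k
  have hgj := hg.pdy hU j
  have hfkj := hfk.pdy hU j
  have hgkj := hgk.pdy hU j
  simp only [(hf.pdy_pdy_mul hU hg k j).pdy i x hx y hy,
    ((hfkj.mul hg).add (hfk.mul hgj)).pdy_add hU ((hfj.mul hgk).add (hf.mul hgkj)) i x hx y hy,
    (hfkj.mul hg).pdy_add hU (hfk.mul hgj) i x hx y hy,
    (hfj.mul hgk).pdy_add hU (hf.mul hgkj) i x hx y hy,
    hfkj.pdy_mul hU hg i x hx y hy, hfk.pdy_mul hU hgj i x hx y hy,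
    hfj.pdy_mul hU hgk i x hx y hy, hf.pdy_mul hU hgkj i x hx y hy]
  ring

end SmoothSlit

@[simp]
theorem pdy_coord (i j : Fin n) (x y : Pt n) :
    pdy (fun _ y => y i) j x y = if i = j then 1 else 0 := by
  have h : HasFDerivAt (fun y' : Pt n => y' i) (ContinuousLinearMap.proj (R := ℝ) i) y :=
    hasFDerivAt_apply i y
  simp [pdy, h.fderiv, Pi.single_apply]

@[simp]
theorem pdx_coord (i j : Fin n) (x y : Pt n) : pdx (fun _ y => y i) j x y = 0 := by
  simp [pdx]

theorem pdy_const_mul (c : ℝ) (hU : IsOpen U) (hf : SmoothSlit U f) (i : Fin n) :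
    EqSlit U (pdy (fun x y => c * f x y) i) fun x y => c * pdy f i x y := by
  intro x hx y hy
  simp only [pdy]
  rw [fderiv_const_mul (hf.differentiableAt_snd hU hx hy)]
  simp

theorem pdx_const_mul (c : ℝ) (hU : IsOpen U) (hf : SmoothSlit U f) (i : Fin n) :
    EqSlit U (pdx (fun x y => c * f x y) i) fun x y => c * pdx f i x y := by
  intro x hx y hy
  simp only [pdx]
  rw [fderiv_const_mul (hf.differentiableAt_fst hU hx hy)]
  simp

namespace HomogSlit

variable {k m : ℤ}

theorem mul {p : ℤ} (hf : HomogSlit U k f) (hg : HomogSlit U m g) (hp : k + m = p) :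
    HomogSlit U p fun x y => f x y * g x y := by
  intro x hx y hy t ht
  simp only [hf x hx y hy t ht, hg x hx y hy t ht, ← hp, zpow_add₀ ht.ne']
  ring

theorem const_mul (c : ℝ) (hf : HomogSlit U k f) : HomogSlit U k fun x y => c * f x y := by
  intro x hx y hy t ht
  simp only [hf x hx y hy t ht]
  ring

theorem sub (hf : HomogSlit U k f) (hg : HomogSlit U k g) :
    HomogSlit U k fun x y => f x y - g x y := by
  intro x hx y hy t ht
  simp only [hf x hx y hy t ht, hg x hx y hy t ht]
  ring

theorem sum {ι : Type*} {s : Finset ι} {f : ι → Pt n → Pt n → ℝ}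
    (hf : ∀ r ∈ s, HomogSlit U k (f r)) : HomogSlit U k fun x y => ∑ r ∈ s, f r x y := by
  intro x hx y hy t ht
  simp only [Finset.mul_sum]
  exact Finset.sum_congr rfl fun r hr => hf r hr x hx y hy t ht

theorem coord (i : Fin n) : HomogSlit U 1 fun _ y => y i := by
  intro x hx y hy t ht
  simp

theorem pdy (hU : IsOpen U) (hs : SmoothSlit U f) (hf : HomogSlit U k f) (i : Fin n) :
    HomogSlit U (k - 1) (pdy f i) := by
  intro x hx y hy t ht
  have hty : t • y ≠ 0 := smul_ne_zero ht.ne' hy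
  have h1 : HasFDerivAt (fun y' => f x (t • y'))
      ((fderiv ℝ (fun y' => f x y') (t • y)).comp (t • ContinuousLinearMap.id ℝ (Pt n))) y :=
    (hs.differentiableAt_snd hU hx hty).hasFDerivAt.comp y
      ((hasFDerivAt_id y).const_smul t)
  have h2 : HasFDerivAt (fun y' => t ^ k * f x y')
      (t ^ k • fderiv ℝ (fun y' => f x y') y) y :=
    (hs.differentiableAt_snd hU hx hy).hasFDerivAt.const_mul _
  have h3 : (fun y' => f x (t • y')) =ᶠ[nhds y] fun y' => t ^ k * f x y' := by
    filter_upwards [isOpen_ne.mem_nhds hy] with z hz using hf x hx z hz t ht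
  have h4 := congrArg (fun L => L (Pi.single i 1)) (h1.unique (h2.congr_of_eventuallyEq h3))
  simp only [ContinuousLinearMap.comp_apply, _root_.smul_apply,
    ContinuousLinearMap.id_apply, map_smul, smul_eq_mul] at h4
  simp only [_root_.pdy]
  rw [zpow_sub_one₀ ht.ne']
  field_simp
  linarith

theorem pdx (hU : IsOpen U) (hs : SmoothSlit U f) (hf : HomogSlit U k f) (i : Fin n) :
    HomogSlit U k (pdx f i) := by
  intro x hx y hy t ht
  have h3 : (fun x' => f x' (t • y)) =ᶠ[nhds x] fun x' => t ^ k * f x' y := by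
    filter_upwards [hU.mem_nhds hx] with z hz using hf z hz y hy t ht
  simp only [_root_.pdx]
  rw [h3.fderiv_eq, fderiv_const_mul (hs.differentiableAt_fst hU hx hy)]
  simp

/-- Euler's theorem for homogeneous functions. -/
theorem euler (hU : IsOpen U) (hs : SmoothSlit U f) (hf : HomogSlit U k f) :
    EqSlit U (fun x y => ∑ i, y i * _root_.pdy f i x y) fun x y => k * f x y := by
  intro x hx y hy
  have h1 : HasDerivAt (fun t : ℝ => f x (t • y))
      (fderiv ℝ (fun y' => f x y') ((1 : ℝ) • y) ((1 : ℝ) • y)) 1 := by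
    refine HasFDerivAt.comp_hasDerivAt (1 : ℝ)
      (l := fun y' => f x y') ?_ ((hasDerivAt_id (1 : ℝ)).smul_const y)
    exact (hs.differentiableAt_snd hU hx (by simpa using hy)).hasFDerivAt
  have h2 : HasDerivAt (fun t : ℝ => t ^ k * f x y) (k * (1 : ℝ) ^ (k - 1) * f x y) 1 :=
    (hasDerivAt_zpow k 1 (Or.inl one_ne_zero)).mul_const _
  have h3 : (fun t : ℝ => f x (t • y)) =ᶠ[nhds 1] fun t : ℝ => t ^ k * f x y := by
    filter_upwards [lt_mem_nhds one_pos] with t ht using hf x hx y hy t ht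
  have h4 := h1.unique (h2.congr_of_eventuallyEq h3)
  simp only [one_smul, one_zpow, mul_one] at h4
  have h5 := congrArg (fderiv ℝ (fun y' => f x y') y) (pi_eq_sum_univ' y)
  simp only [← h4, h5, map_sum, map_smul, smul_eq_mul, _root_.pdy]

end HomogSlit

end SmoothCalculus

section IteratedFiberDerivatives

variable {n : ℕ} {U : Set (Pt n)} {f : Pt n → Pt n → ℝ}

theorem SmoothSlit.pdy_rotate_three (hU : IsOpen U) (hf : SmoothSlit U f) (m k j : Fin n) :
    EqSlit U (_root_.pdy (_root_.pdy (_root_.pdy f m) k) j)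
      (_root_.pdy (_root_.pdy (_root_.pdy f k) j) m) :=
  ((hf.pdy_pdy_comm hU m k).pdy j).trans ((hf.pdy hU k).pdy_pdy_comm hU m j)

theorem SmoothSlit.pdy_rotate_four (hU : IsOpen U) (hf : SmoothSlit U f) (m k j i : Fin n) :
    EqSlit U (_root_.pdy (_root_.pdy (_root_.pdy (_root_.pdy f m) k) j) i)
      (_root_.pdy (_root_.pdy (_root_.pdy (_root_.pdy f k) j) i) m) :=
  ((hf.pdy_rotate_three hU m k j).pdy i).trans
    (((hf.pdy hU k).pdy hU j).pdy_pdy_comm hU m i)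

theorem SmoothSlit.pdx_pdy_pdy_pdy_comm (hU : IsOpen U) (hf : SmoothSlit U f)
    (k j i m : Fin n) :
    EqSlit U (_root_.pdx (_root_.pdy (_root_.pdy (_root_.pdy f k) j) i) m)
      (_root_.pdy (_root_.pdy (_root_.pdy (_root_.pdx f m) k) j) i) :=
  ((((hf.pdy hU k).pdy hU j).pdx_pdy_comm hU i m).trans
    (((hf.pdy hU k).pdx_pdy_comm hU j m).pdy i)).trans
    (((hf.pdx_pdy_comm hU k m).pdy j).pdy i)

theorem SmoothSlit.pdy_pdy_pdy_sum (hU : IsOpen U) {ι : Type*} {s : Finset ι}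
    {f : ι → Pt n → Pt n → ℝ} (hf : ∀ r ∈ s, SmoothSlit U (f r)) (k j i : Fin n) :
    EqSlit U (_root_.pdy (_root_.pdy (_root_.pdy (fun x y => ∑ r ∈ s, f r x y) k) j) i)
      fun x y => ∑ r ∈ s, _root_.pdy (_root_.pdy (_root_.pdy (f r) k) j) i x y :=
  ((((SmoothSlit.pdy_sum hU hf k).pdy j).trans
    (SmoothSlit.pdy_sum hU (fun r hr => (hf r hr).pdy hU k) j)).pdy i).trans
    (SmoothSlit.pdy_sum hU (fun r hr => ((hf r hr).pdy hU k).pdy hU j) i)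

theorem HomogSlit.euler_pdy {d : ℤ} (hU : IsOpen U) (hs : SmoothSlit U f)
    (hf : HomogSlit U d f) (k : Fin n) :
    EqSlit U (fun x y => ∑ m, y m * _root_.pdy (_root_.pdy f m) k x y)
      fun x y => (d - 1 : ℤ) * _root_.pdy f k x y := by
  intro x hx y hy
  simp only [fun m => hs.pdy_pdy_comm hU m k x hx y hy]
  exact (hf.pdy hU hs k).euler hU (hs.pdy hU k) x hx y hy

theorem HomogSlit.euler_pdy_pdy {d : ℤ} (hU : IsOpen U) (hs : SmoothSlit U f)
    (hf : HomogSlit U d f) (k j : Fin n) :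
    EqSlit U (fun x y => ∑ m, y m * _root_.pdy (_root_.pdy (_root_.pdy f m) k) j x y)
      fun x y => (d - 1 - 1 : ℤ) * _root_.pdy (_root_.pdy f k) j x y := by
  intro x hx y hy
  simp only [fun m => hs.pdy_rotate_three hU m k j x hx y hy]
  exact ((hf.pdy hU hs k).pdy hU (hs.pdy hU k) j).euler hU ((hs.pdy hU k).pdy hU j) x hx y hy

theorem HomogSlit.euler_pdy_pdy_pdy {d : ℤ} (hU : IsOpen U) (hs : SmoothSlit U f)
    (hf : HomogSlit U d f) (k j i : Fin n) :
    EqSlit U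
      (fun x y => ∑ m, y m * _root_.pdy (_root_.pdy (_root_.pdy (_root_.pdy f m) k) j) i x y)
      fun x y => (d - 1 - 1 - 1 : ℤ) * _root_.pdy (_root_.pdy (_root_.pdy f k) j) i x y := by
  intro x hx y hy
  simp only [fun m => hs.pdy_rotate_four hU m k j i x hx y hy]
  exact (((hf.pdy hU hs k).pdy hU (hs.pdy hU k) j).pdy hU ((hs.pdy hU k).pdy hU j) i).euler hU
    (((hs.pdy hU k).pdy hU j).pdy hU i) x hx y hy

end IteratedFiberDerivatives

namespace IsFinslerMetric

variable {n : ℕ} {U : Set (Pt n)} {F : Pt n → Pt n → ℝ}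

theorem smoothSlit (hF : IsFinslerMetric U F) : SmoothSlit U F := hF.smooth

theorem smooth_F2 (hF : IsFinslerMetric U F) : SmoothSlit U (F2 F) :=
  (hF.smoothSlit.mul hF.smoothSlit).congr fun x _ y _ => pow_two (F x y)

theorem homog_F2 (hF : IsFinslerMetric U F) : HomogSlit U 2 (F2 F) := by
  intro x hx y hy t ht
  simp only [F2, hF.homog x hx y hy t ht]
  norm_cast
  ring

theorem smooth_gLow (hF : IsFinslerMetric U F) (i j : Fin n) : SmoothSlit U (gLow F i j) :=
  (SmoothSlit.const _).mul ((hF.smooth_F2.pdy hF.isOpen j).pdy hF.isOpen i)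

theorem homog_gLow (hF : IsFinslerMetric U F) (i j : Fin n) : HomogSlit U 0 (gLow F i j) :=
  ((hF.homog_F2.pdy hF.isOpen hF.smooth_F2 j).pdy hF.isOpen
    (hF.smooth_F2.pdy hF.isOpen j) i).const_mul _

theorem smooth_gInv (hF : IsFinslerMetric U F) (i j : Fin n) : SmoothSlit U (gInv F i j) :=
  SmoothSlit.matrix_inv (M := gMat F) (fun a b => hF.smooth_gLow a b)
    (fun x hx y hy => (hF.posdef x hx y hy).det_pos.ne') i j

theorem homog_gInv (hF : IsFinslerMetric U F) (i j : Fin n) : HomogSlit U 0 (gInv F i j) := by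
  intro x hx y hy t ht
  have h : gMat F x (t • y) = gMat F x y := by
    ext a b
    simpa [gMat] using hF.homog_gLow a b x hx y hy t ht
  simp [gInv, h]

theorem smooth_Gspray (hF : IsFinslerMetric U F) (i : Fin n) : SmoothSlit U (Gspray F i) := by
  have hU := hF.isOpen
  refine (SmoothSlit.const _).mul (SmoothSlit.sum fun l _ => (hF.smooth_gInv i l).mul
    (SmoothSlit.sub (SmoothSlit.sum fun k _ => (SmoothSlit.coord k).mul ?_) ?_))
  · exact (hF.smooth_F2.pdy hU l).pdx hU k
  · exact hF.smooth_F2.pdx hU l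

theorem homog_Gspray (hF : IsFinslerMetric U F) (i : Fin n) : HomogSlit U 2 (Gspray F i) := by
  have hU := hF.isOpen
  refine (HomogSlit.sum fun l _ => (hF.homog_gInv i l).mul (m := 2)
    (HomogSlit.sub (HomogSlit.sum fun k _ => (HomogSlit.coord k).mul (m := 1) ?_ rfl) ?_)
      rfl).const_mul _
  · exact (hF.homog_F2.pdy hU hF.smooth_F2 l).pdx hU (hF.smooth_F2.pdy hU l) k
  · exact hF.homog_F2.pdx hU hF.smooth_F2 l

theorem yLow_eq (hF : IsFinslerMetric U F) (i : Fin n) :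
    EqSlit U (yLow F i) fun x y => (1 / 2 : ℝ) * pdy (F2 F) i x y := by
  intro x hx y hy
  have h := hF.homog_F2.euler_pdy hF.isOpen hF.smooth_F2 i x hx y hy
  norm_num at h
  simp only [yLow, gLow, ← h, Finset.mul_sum]
  exact Finset.sum_congr rfl fun j _ => by ring

/-- The spray equation, with the metric not inverted. -/
theorem two_mul_sum_Gspray (hF : IsFinslerMetric U F) {x y : Pt n} (hx : x ∈ U) (hy : y ≠ 0)
    (l : Fin n) :
    2 * ∑ r, Gspray F r x y * pdy (pdy (F2 F) r) l x y
      = (∑ k, y k * pdx (pdy (F2 F) l) k x y) - pdx (F2 F) l x y := by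
  set v : Pt n := fun l => (∑ k, y k * pdx (pdy (F2 F) l) k x y) - pdx (F2 F) l x y with hv
  have hG : ∀ r, Gspray F r x y = (1 / 4 : ℝ) * ((gMat F x y)⁻¹.mulVec v) r := fun r => rfl
  have h : (gMat F x y).mulVec ((gMat F x y)⁻¹.mulVec v) = v := by
    rw [Matrix.mulVec_mulVec, Matrix.mul_nonsing_inv _
      (hF.posdef x hx y hy).det_pos.ne'.isUnit, Matrix.one_mulVec]
  have hl := congrFun h l
  rw [Matrix.mulVec, dotProduct] at hl
  change _ = v l
  rw [← hl, Finset.mul_sum]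
  refine Finset.sum_congr rfl fun r _ => ?_
  rw [hG]
  simp only [gMat, Matrix.of_apply, gLow]
  ring

/-- The spray annihilates `F²`. -/
theorem sum_mul_pdx_F2 (hF : IsFinslerMetric U F) :
    EqSlit U (fun x y => ∑ k, y k * pdx (F2 F) k x y)
      fun x y => 2 * ∑ r, Gspray F r x y * pdy (F2 F) r x y := by
  intro x hx y hy
  have hU := hF.isOpen
  have hE := hF.smooth_F2
  have h1 : ∑ l, y l * (2 * ∑ r, Gspray F r x y * pdy (pdy (F2 F) r) l x y)
      = 2 * ∑ r, Gspray F r x y * pdy (F2 F) r x y := by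
    simp only [Finset.mul_sum]
    rw [Finset.sum_comm]
    refine Finset.sum_congr rfl fun r _ => ?_
    have h := (hF.homog_F2.pdy hU hE r).euler hU (hE.pdy hU r) x hx y hy
    norm_num at h
    rw [← h]
    simp only [Finset.mul_sum]
    exact Finset.sum_congr rfl fun l _ => by ring
  have h2 : ∑ l, y l * ∑ k, y k * pdx (pdy (F2 F) l) k x y
      = 2 * ∑ k, y k * pdx (F2 F) k x y := by
    simp only [Finset.mul_sum]
    rw [Finset.sum_comm]
    refine Finset.sum_congr rfl fun k _ => ?_
    have h := (hF.homog_F2.pdx hU hE k).euler hU (hE.pdx hU k) x hx y hy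
    norm_num at h
    simp only [fun l => hE.pdx_pdy_comm hU l k x hx y hy]
    calc _ = y k * ∑ l, y l * pdy (pdx (F2 F) k) l x y := by
          rw [Finset.mul_sum]
          exact Finset.sum_congr rfl fun l _ => by ring
      _ = _ := by rw [h]; ring
  simp only [hF.two_mul_sum_Gspray hx hy, mul_sub, Finset.sum_sub_distrib] at h1
  rw [h2] at h1
  beta_reduce
  linarith

theorem pdx_F2_eq (hF : IsFinslerMetric U F) (l : Fin n) :
    EqSlit U (pdx (F2 F) l) fun x y => ∑ r, Ncon F r l x y * pdy (F2 F) r x y := by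
  intro x hx y hy
  have hU := hF.isOpen
  have hE := hF.smooth_F2
  have hG := hF.smooth_Gspray
  have h := hF.sum_mul_pdx_F2.pdy l x hx y hy
  rw [pdy_const_mul 2 hU (SmoothSlit.sum fun r _ => (hG r).mul (hE.pdy hU r)) l x hx y hy,
    SmoothSlit.pdy_sum hU (fun k _ => (SmoothSlit.coord k).mul (hE.pdx hU k)) l x hx y hy] at h
  beta_reduce at h
  rw [SmoothSlit.pdy_sum hU (fun r _ => (hG r).mul (hE.pdy hU r)) l x hx y hy] at h
  simp only [fun k => (SmoothSlit.coord k).pdy_mul hU (hE.pdx hU k) l x hx y hy,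
    fun r => (hG r).pdy_mul hU (hE.pdy hU r) l x hx y hy, Finset.sum_add_distrib, pdy_coord,
    ite_mul, one_mul, zero_mul, Finset.sum_ite_eq', Finset.mem_univ, if_true, mul_add,
    hF.two_mul_sum_Gspray hx hy, ← fun k => hE.pdx_pdy_comm hU l k x hx y hy] at h
  simp only [Ncon]
  linarith

/-- `F²` is horizontally constant. -/
theorem hD0_F2 (hF : IsFinslerMetric U F) {x y : Pt n} (hx : x ∈ U) (hy : y ≠ 0) (m : Fin n) :
    hD0 F (F2 F) m x y = 0 := by
  simp only [hD0, hF.pdx_F2_eq m x hx y hy, sub_self]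

theorem hD0_mul (hF : IsFinslerMetric U F) {f g : Pt n → Pt n → ℝ} (hf : SmoothSlit U f)
    (hg : SmoothSlit U g) {x y : Pt n} (hx : x ∈ U) (hy : y ≠ 0) (m : Fin n) :
    hD0 F (fun x y => f x y * g x y) m x y = hD0 F f m x y * g x y + f x y * hD0 F g m x y := by
  have hU := hF.isOpen
  simp only [hD0, hf.pdx_mul hU hg m x hx y hy, fun r => hf.pdy_mul hU hg r x hx y hy, mul_add,
    Finset.sum_add_distrib, sub_mul, mul_sub, Finset.sum_mul, Finset.mul_sum]
  have h1 : ∀ r, Ncon F r m x y * (pdy f r x y * g x y)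
      = Ncon F r m x y * pdy f r x y * g x y := fun r => by ring
  have h2 : ∀ r, Ncon F r m x y * (f x y * pdy g r x y)
      = f x y * (Ncon F r m x y * pdy g r x y) := fun r => by ring
  simp only [h1, h2]
  ring

theorem hD0_const_mul (hF : IsFinslerMetric U F) (c : ℝ) {f : Pt n → Pt n → ℝ}
    (hf : SmoothSlit U f) {x y : Pt n} (hx : x ∈ U) (hy : y ≠ 0) (m : Fin n) :
    hD0 F (fun x y => c * f x y) m x y = c * hD0 F f m x y := by
  rw [hF.hD0_mul (SmoothSlit.const c) hf hx hy]
  simp [hD0, pdx, pdy]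

/-- `F` is horizontally constant. -/
theorem hD0_self (hF : IsFinslerMetric U F) {x y : Pt n} (hx : x ∈ U) (hy : y ≠ 0)
    (m : Fin n) : hD0 F F m x y = 0 := by
  have h : F2 F = fun x y => F x y * F x y := by
    funext x y
    exact pow_two _
  have h1 := hF.hD0_F2 hx hy m
  rw [h, hF.hD0_mul hF.smoothSlit hF.smoothSlit hx hy] at h1
  have h2 := hF.pos x hx y hy
  exact (mul_eq_zero.mp (show F x y * hD0 F F m x y = 0 by linarith)).resolve_left h2.ne'

theorem hD0_congr (hF : IsFinslerMetric U F) {f g : Pt n → Pt n → ℝ} (h : EqSlit U f g)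
    (m : Fin n) : EqSlit U (hD0 F f m) (hD0 F g m) := by
  intro x hx y hy
  simp only [hD0, h.pdx hF.isOpen m x hx y hy, fun r => h.pdy r x hx y hy]

theorem hD3_congr (hF : IsFinslerMetric U F) {S T : Fin n → Fin n → Fin n → Pt n → Pt n → ℝ}
    (h : ∀ i j k, EqSlit U (S i j k) (T i j k)) (i j k m : Fin n) :
    EqSlit U (hD3 F S i j k m) (hD3 F T i j k m) := by
  intro x hx y hy
  simp only [hD3, hF.hD0_congr (h i j k) m x hx y hy, fun a b c => h a b c x hx y hy]

theorem hD3_mul (hF : IsFinslerMetric U F) {s : Pt n → Pt n → ℝ}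
    {T : Fin n → Fin n → Fin n → Pt n → Pt n → ℝ} (hs : SmoothSlit U s)
    (hT : ∀ i j k, SmoothSlit U (T i j k)) {x y : Pt n} (hx : x ∈ U) (hy : y ≠ 0)
    (i j k m : Fin n) :
    hD3 F (fun i j k x y => s x y * T i j k x y) i j k m x y
      = hD0 F s m x y * T i j k x y + s x y * hD3 F T i j k m x y := by
  simp only [hD3, hF.hD0_mul hs (hT i j k) hx hy m, mul_sub, Finset.mul_sum, mul_assoc]
  ring

theorem sum_mul_Ncon (hF : IsFinslerMetric U F) {x y : Pt n} (hx : x ∈ U) (hy : y ≠ 0)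
    (r : Fin n) : ∑ m, y m * Ncon F r m x y = 2 * Gspray F r x y := by
  simpa [Ncon] using (hF.homog_Gspray r).euler hF.isOpen (hF.smooth_Gspray r) x hx y hy

theorem sum_mul_Γcon (hF : IsFinslerMetric U F) {x y : Pt n} (hx : x ∈ U) (hy : y ≠ 0)
    (r i : Fin n) : ∑ m, y m * Γcon F r i m x y = Ncon F r i x y := by
  have h := (hF.homog_Gspray r).euler_pdy hF.isOpen (hF.smooth_Gspray r) i x hx y hy
  norm_num at h
  exact h

theorem sum_mul_Γcon_left (hF : IsFinslerMetric U F) {x y : Pt n} (hx : x ∈ U) (hy : y ≠ 0)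
    (r i : Fin n) : ∑ m, y m * Γcon F r m i x y = Ncon F r i x y := by
  rw [← hF.sum_mul_Γcon hx hy]
  exact Finset.sum_congr rfl fun m _ =>
    congrArg _ ((hF.smooth_Gspray r).pdy_pdy_comm hF.isOpen i m x hx y hy)

/-- The covariant derivative of a 3-tensor along the spray. -/
theorem sum_hD3_mul (hF : IsFinslerMetric U F) (T : Fin n → Fin n → Fin n → Pt n → Pt n → ℝ)
    {x y : Pt n} (hx : x ∈ U) (hy : y ≠ 0) (i j k : Fin n) :
    ∑ m, hD3 F T i j k m x y * y m
      = (∑ m, y m * pdx (T i j k) m x y)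
        - ∑ r, (2 * Gspray F r x y * pdy (T i j k) r x y + T r j k x y * Ncon F r i x y
          + T i r k x y * Ncon F r j x y + T i j r x y * Ncon F r k x y) := by
  have hN : ∑ r, 2 * Gspray F r x y * pdy (T i j k) r x y
      = ∑ m, (∑ r, Ncon F r m x y * pdy (T i j k) r x y) * y m := by
    simp only [← hF.sum_mul_Ncon hx hy, Finset.sum_mul]
    rw [Finset.sum_comm]
    exact Finset.sum_congr rfl fun m _ => Finset.sum_congr rfl fun r _ => by ring
  have hΓ : ∀ (a : Fin n → ℝ) (p : Fin n), ∑ r, a r * Ncon F r p x y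
      = ∑ m, (∑ r, a r * Γcon F r p m x y) * y m := by
    intro a p
    simp only [← hF.sum_mul_Γcon hx hy, Finset.sum_mul, Finset.mul_sum]
    rw [Finset.sum_comm]
    exact Finset.sum_congr rfl fun m _ => Finset.sum_congr rfl fun r _ => by ring
  simp only [Finset.sum_add_distrib, hN, hΓ, hD3, hD0, sub_mul, Finset.sum_sub_distrib,
    mul_comm (y _)]
  ring

theorem smooth_Cartan (hF : IsFinslerMetric U F) (i j k : Fin n) :
    SmoothSlit U (Cartan F i j k) :=
  (SmoothSlit.const _).mul
    (((hF.smooth_F2.pdy hF.isOpen k).pdy hF.isOpen j).pdy hF.isOpen i)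

theorem sum_mul_Cartan (hF : IsFinslerMetric U F) {x y : Pt n} (hx : x ∈ U) (hy : y ≠ 0)
    (i j : Fin n) : ∑ l, y l * Cartan F i j l x y = 0 := by
  have h := hF.homog_F2.euler_pdy_pdy hF.isOpen hF.smooth_F2 j i x hx y hy
  norm_num at h
  calc _ = (1 / 4 : ℝ) * ∑ l, y l * pdy (pdy (pdy (F2 F) l) j) i x y := by
        rw [Finset.mul_sum]
        exact Finset.sum_congr rfl fun l _ => by rw [Cartan]; ring
    _ = 0 := by rw [h, mul_zero]

/-- Since `yˡ_{|k} = 0`, covariant differentiation preserves transversality to `y`. -/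
theorem sum_mul_hD3_eq_zero (hF : IsFinslerMetric U F)
    {T : Fin n → Fin n → Fin n → Pt n → Pt n → ℝ} (hT : ∀ i j k, SmoothSlit U (T i j k))
    (h0 : ∀ i j, EqSlit U (fun x y => ∑ l, y l * T i j l x y) fun _ _ => 0) {x y : Pt n}
    (hx : x ∈ U) (hy : y ≠ 0) (i j k : Fin n) : ∑ l, y l * hD3 F T i j l k x y = 0 := by
  have hU := hF.isOpen
  have hc : ∀ l, SmoothSlit U fun x y => y l * T i j l x y :=
    fun l => (SmoothSlit.coord l).mul (hT i j l)
  have h1 : ∑ l, y l * pdx (T i j l) k x y = 0 := by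
    have h := (h0 i j).pdx hU k x hx y hy
    rw [SmoothSlit.pdx_sum hU (fun l _ => hc l) k x hx y hy] at h
    simp only [fun l => (SmoothSlit.coord l).pdx_mul hU (hT i j l) k x hx y hy, pdx_coord,
      zero_mul, zero_add] at h
    simpa [pdx] using h
  have h2 : ∀ r, ∑ l, y l * pdy (T i j l) r x y = -T i j r x y := by
    intro r
    have h := (h0 i j).pdy r x hx y hy
    rw [SmoothSlit.pdy_sum hU (fun l _ => hc l) r x hx y hy] at h
    simp only [fun l => (SmoothSlit.coord l).pdy_mul hU (hT i j l) r x hx y hy, pdy_coord,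
      ite_mul, one_mul, zero_mul, Finset.sum_add_distrib, Finset.sum_ite_eq', Finset.mem_univ,
      if_true] at h
    have h' : pdy (fun _ _ => (0 : ℝ)) r x y = 0 := by simp [pdy]
    linarith
  have h3 : ∑ l, ∑ r, y l * (Ncon F r k x y * pdy (T i j l) r x y)
      = -∑ r, T i j r x y * Ncon F r k x y := by
    rw [Finset.sum_comm, ← Finset.sum_neg_distrib]
    refine Finset.sum_congr rfl fun r _ => ?_
    rw [← neg_mul, ← h2, Finset.sum_mul]
    exact Finset.sum_congr rfl fun l _ => by ring
  have h4 : ∀ a b : Fin n → Fin n → Fin n, ∀ c : Fin n → ℝ,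
      (∀ r, ∑ l, y l * T (a i r) (b j r) l x y = 0) →
      ∑ l, ∑ r, y l * (T (a i r) (b j r) l x y * c r) = 0 := by
    intro a b c h
    rw [Finset.sum_comm]
    refine Finset.sum_eq_zero fun r _ => ?_
    simp only [← mul_assoc, ← Finset.sum_mul, h, zero_mul]
  have h5 : ∑ l, ∑ r, y l * (T i j r x y * Γcon F r l k x y)
      = ∑ r, T i j r x y * Ncon F r k x y := by
    rw [Finset.sum_comm]
    refine Finset.sum_congr rfl fun r _ => ?_
    rw [← hF.sum_mul_Γcon_left hx hy, Finset.mul_sum]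
    exact Finset.sum_congr rfl fun l _ => by ring
  simp only [hD3, hD0, mul_sub, Finset.sum_sub_distrib, Finset.mul_sum]
  rw [h1, h3, h5, h4 (fun _ r => r) (fun j _ => j) (fun r => Γcon F r i k x y)
      (fun r => h0 r j x hx y hy),
    h4 (fun i _ => i) (fun _ r => r) (fun r => Γcon F r j k x y) (fun r => h0 i r x hx y hy)]
  ring

/-- The Landsberg curvature as the contraction of the Berwald curvature with
`y_r = (1/2) ∂F²/∂yʳ`. -/
theorem Land_eq (hF : IsFinslerMetric U F) {x y : Pt n} (hx : x ∈ U) (hy : y ≠ 0)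
    (i j k : Fin n) :
    Land F i j k x y = -(1 / 4 : ℝ) * ∑ r, Bcurv F r i j k x y * pdy (F2 F) r x y := by
  have hU := hF.isOpen
  have hE := hF.smooth_F2
  have hG := hF.smooth_Gspray
  have hN : ∀ r m, SmoothSlit U (Ncon F r m) := fun r m => (hG r).pdy hU m
  have hx3 : ∀ m, pdx (pdy (pdy (pdy (F2 F) k) j) i) m x y
      = ∑ r, pdy (pdy (pdy (fun x y => Ncon F r m x y * pdy (F2 F) r x y) k) j) i x y := by
    intro m
    rw [hE.pdx_pdy_pdy_pdy_comm hU k j i m x hx y hy,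
      (((hF.pdx_F2_eq m).pdy k).pdy j).pdy i x hx y hy]
    exact SmoothSlit.pdy_pdy_pdy_sum hU (fun r _ => (hN r m).mul (hE.pdy hU r)) k j i x hx y hy
  have key : ∀ r,
      ∑ m, y m * pdy (pdy (pdy (fun x y => Ncon F r m x y * pdy (F2 F) r x y) k) j) i x y
        = -Bcurv F r i j k x y * pdy (F2 F) r x y
          + Ncon F r k x y * pdy (pdy (pdy (F2 F) r) j) i x y
          + Ncon F r j x y * pdy (pdy (pdy (F2 F) r) k) i x y
          + Ncon F r i x y * pdy (pdy (pdy (F2 F) r) k) j x y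
          + 2 * Gspray F r x y * pdy (pdy (pdy (pdy (F2 F) r) k) j) i x y := by
    intro r
    have e3 := (hF.homog_Gspray r).euler_pdy_pdy_pdy hU (hG r) k j i x hx y hy
    have e2 := fun a b => (hF.homog_Gspray r).euler_pdy_pdy hU (hG r) a b x hx y hy
    have e1 := fun a => (hF.homog_Gspray r).euler_pdy hU (hG r) a x hx y hy
    have e0 := hF.sum_mul_Ncon hx hy r
    norm_num at e3 e2 e1
    simp only [fun m => (hN r m).pdy_pdy_pdy_mul hU (hE.pdy hU r) k j i x hx y hy, mul_add,
      Finset.sum_add_distrib, ← mul_assoc, ← Finset.sum_mul, e0]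
    simp only [Ncon, e3, e2, e1, Bcurv]
    ring
  have hC : ∀ m, pdx (Cartan F i j k) m x y
      = (1 / 4 : ℝ) * pdx (pdy (pdy (pdy (F2 F) k) j) i) m x y := fun m =>
    pdx_const_mul _ hU (((hE.pdy hU k).pdy hU j).pdy hU i) m x hx y hy
  have hCy : ∀ r, pdy (Cartan F i j k) r x y
      = (1 / 4 : ℝ) * pdy (pdy (pdy (pdy (F2 F) r) k) j) i x y := fun r =>
    (pdy_const_mul _ hU (((hE.pdy hU k).pdy hU j).pdy hU i) r x hx y hy).trans
      (congrArg _ (hE.pdy_rotate_four hU r k j i x hx y hy).symm)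
  have h1 : ∑ m, y m * pdx (Cartan F i j k) m x y
      = (1 / 4 : ℝ) * ∑ r, ∑ m,
        y m * pdy (pdy (pdy (fun x y => Ncon F r m x y * pdy (F2 F) r x y) k) j) i x y := by
    rw [Finset.sum_comm, Finset.mul_sum]
    refine Finset.sum_congr rfl fun m _ => ?_
    rw [hC, hx3, ← Finset.mul_sum]
    ring
  rw [Land, hF.sum_hD3_mul _ hx hy, h1, Finset.mul_sum, Finset.mul_sum,
    ← Finset.sum_sub_distrib]
  refine Finset.sum_congr rfl fun r _ => ?_
  rw [key, hCy]
  simp only [Cartan]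
  rw [← hE.pdy_rotate_three hU r k j x hx y hy, (hE.pdy_pdy_comm hU k r).pdy i x hx y hy]
  ring

end IsFinslerMetric

namespace IsGIB

variable {n : ℕ} {U : Set (Pt n)} {F μ lam : Pt n → Pt n → ℝ}

theorem Land_eq (hF : IsGIB U F μ lam) (i j k : Fin n) :
    EqSlit U (Land F i j k)
      fun x y => (-(1 / 2 : ℝ) * μ x y) * F x y * Cartan F i j k x y := by
  intro x hx y hy
  have hM := hF.finsler
  have hpos := hM.pos x hx y hy
  have hE : ∑ r, y r * pdy (F2 F) r x y = 2 * F x y ^ 2 := by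
    simpa [F2] using hM.homog_F2.euler hM.isOpen hM.smooth_F2 x hx y hy
  have hell : ∑ r, ell F r x y * pdy (F2 F) r x y = 2 * F x y := by
    simp only [ell, div_mul_eq_mul_div, ← Finset.sum_div, hE]
    field_simp
  have hup : ∀ j, ∑ r, hUp F r j x y * pdy (F2 F) r x y = 0 := by
    intro j
    simp only [hUp, sub_mul, Finset.sum_sub_distrib, ite_mul, one_mul, zero_mul,
      Finset.sum_ite_eq', Finset.mem_univ, if_true, hM.yLow_eq j x hx y hy]
    have : ∀ r, y r * (1 / 2 * pdy (F2 F) j x y) / F x y ^ 2 * pdy (F2 F) r x y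
        = (1 / 2 * pdy (F2 F) j x y) / F x y ^ 2 * (y r * pdy (F2 F) r x y) := fun r => by ring
    simp only [this, ← Finset.mul_sum, hE]
    field_simp
    ring
  have hsum : ∑ r, Bcurv F r i j k x y * pdy (F2 F) r x y
      = μ x y * Cartan F i j k x y * (∑ r, ell F r x y * pdy (F2 F) r x y)
        + lam x y * ((∑ r, hUp F r i x y * pdy (F2 F) r x y) * hLow F j k x y
          + (∑ r, hUp F r j x y * pdy (F2 F) r x y) * hLow F i k x y
          + (∑ r, hUp F r k x y * pdy (F2 F) r x y) * hLow F i j x y) := by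
    simp only [hF.berwald x hx y hy, Finset.sum_mul, Finset.mul_sum, ← Finset.sum_add_distrib]
    exact Finset.sum_congr rfl fun r _ => by ring
  rw [hM.Land_eq hx hy, hsum, hell, hup, hup, hup]
  ring

end IsGIB

/-- For a generalized isotropic Berwald metric with vanishing stretch curvature,
`(μ' - (1/2) μ² F) C_{ijk} = 0`, where `μ' := μ_{|s} yˢ`. -/
theorem gib_stretch_zero_key_identity {n : ℕ} (U : Set (Pt n))
    (F μ lam : Pt n → Pt n → ℝ) (hF : IsGIB U F μ lam)
    (hstretch : ∀ x ∈ U, ∀ y : Pt n, y ≠ 0 → ∀ i j k l : Fin n,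
      Stretch F i j k l x y = 0) :
    ∀ x ∈ U, ∀ y : Pt n, y ≠ 0 → ∀ i j k : Fin n,
      ((∑ s, hD0 F μ s x y * y s) - (1 / 2 : ℝ) * (μ x y) ^ 2 * F x y)
        * Cartan F i j k x y = 0 := by
  intro x hx y hy i j k
  have hM := hF.finsler
  have hpos := hM.pos x hx y hy
  have hμ : SmoothSlit U μ := hF.smooth_mu
  have hcμ : SmoothSlit U fun x y => -(1 / 2 : ℝ) * μ x y := (SmoothSlit.const _).mul hμ
  have hs : SmoothSlit U fun x y => (-(1 / 2 : ℝ) * μ x y) * F x y := hcμ.mul hM.smoothSlit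
  have hLsmooth : ∀ i j k, SmoothSlit U (Land F i j k) := fun i j k =>
    (hs.mul (hM.smooth_Cartan i j k)).congr (hF.Land_eq i j k)
  have hL0 : ∀ i j, EqSlit U (fun x y => ∑ l, y l * Land F i j l x y) fun _ _ => 0 := by
    intro i j x hx y hy
    simp only [fun l => hF.Land_eq i j l x hx y hy, mul_left_comm (y _), ← Finset.mul_sum,
      hM.sum_mul_Cartan hx hy, mul_zero]
  have h1 : ∑ l, hD3 F (Land F) i j k l x y * y l = 0 := by
    rw [← hM.sum_mul_hD3_eq_zero hLsmooth hL0 hx hy i j k]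
    refine Finset.sum_congr rfl fun l _ => ?_
    have h := hstretch x hx y hy i j k l
    rw [Stretch] at h
    rw [mul_comm, show hD3 F (Land F) i j k l x y = hD3 F (Land F) i j l k x y by linarith]
  have h2 : ∀ l, hD3 F (Land F) i j k l x y
      = -(1 / 2 : ℝ) * F x y * Cartan F i j k x y * hD0 F μ l x y
        + -(1 / 2 : ℝ) * μ x y * F x y * hD3 F (Cartan F) i j k l x y := by
    intro l
    rw [hM.hD3_congr hF.Land_eq i j k l x hx y hy, hM.hD3_mul hs hM.smooth_Cartan hx hy,
      hM.hD0_mul hcμ hM.smoothSlit hx hy, hM.hD0_const_mul _ hμ hx hy, hM.hD0_self hx hy]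
    ring
  simp only [h2, add_mul, Finset.sum_add_distrib, mul_assoc, ← Finset.mul_sum] at h1
  have h3 : ∑ l, hD3 F (Cartan F) i j k l x y * y l
      = (-(1 / 2 : ℝ) * μ x y) * F x y * Cartan F i j k x y := hF.Land_eq i j k x hx y hy
  rw [h3] at h1
  refine (mul_eq_zero.mp (?_ : F x y * _ = 0)).resolve_left hpos.ne'
  linear_combination (-2) * h1
end

section
/- Let ι be a type, let N be a real number with N > 2, and let A : ι → ι → ι → ℝ satisfy (i) A(j,k,l) = A(k,j,l) for all j,k,l (symmetry in the first two arguments) and (ii) N·A(j,k,l) = A(j,l,k) + A(k,l,j) for all j,k,l. Then A is totally symmetric in all three arguments and A(j,k,l) = 0 for all j,k,l. -/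
/-- **Algebraic lemma.** If `A` is symmetric in its first two arguments and satisfies
`N·A(j,k,l) = A(j,l,k) + A(k,l,j)` with `N > 2`, then `A` is totally symmetric and zero. -/
theorem symmetric_trilinear_relation_forces_zero {ι : Type*} (N : ℝ) (hN : 2 < N)
    (A : ι → ι → ι → ℝ)
    (hsym : ∀ j k l, A j k l = A k j l)
    (hrel : ∀ j k l, N * A j k l = A j l k + A k l j) :
    (∀ j k l, A j k l = A j l k) ∧ (∀ j k l, A j k l = A l k j) ∧
      (∀ j k l, A j k l = 0) := by
  have hzero : ∀ j k l, A j k l = 0 := by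
    intro j k l
    have h₁ := hrel j k l
    have h₂ := hrel j l k
    have h₃ := hrel k l j
    rw [hsym l k j] at h₂
    rw [hsym k j l, hsym l j k] at h₃
    have hab : A j k l = A j l k :=
      mul_left_cancel₀ (show N + 1 ≠ 0 by linarith) (by linarith)
    have hac : A j k l = A k l j :=
      mul_left_cancel₀ (show N + 1 ≠ 0 by linarith) (by linarith)
    refine (mul_eq_zero.mp (?_ : (N - 2) * A j k l = 0)).resolve_left (by linarith)
    linarith
  simp [hzero]
end

section
/- Every R-quadratic Finsler metric is a stretch metric: if R^i_{jkl}(x,y) is independent of y, then Σ_{ijkl} = 0 at every point of U × (ℝ^n ∖ {0}). -/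
section SprayAlgebra

open Finset

/-- An algebraic model of the geodesic spray of a Finsler metric: `X` and `Y` are the base and fibre
partial derivatives, `E` the squared metric, and `G` the spray coefficients. -/
structure SprayAlgebra (ι A : Type*) [Fintype ι] [DecidableEq ι] [CommRing A] [Algebra ℝ A] where
  X : ι → Derivation ℝ A A
  Y : ι → Derivation ℝ A A
  XX : ∀ i j a, X i (X j a) = X j (X i a)
  XY : ∀ i j a, X i (Y j a) = Y j (X i a)
  YY : ∀ i j a, Y i (Y j a) = Y j (Y i a)
  y : ι → A
  X_y : ∀ i j, X i (y j) = 0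
  Y_y : ∀ i j, Y i (y j) = if i = j then 1 else 0
  E : A
  euler : ∑ k, y k * Y k E = 2 * E
  nondegenerate : ∀ v : ι → A, (∀ l, ∑ i, Y l (Y i E) * v i = 0) → ∀ i, v i = 0
  G : ι → A
  spray : ∀ l, ∑ i, Y l (Y i E) * (2 * G i) = ∑ k, y k * X k (Y l E) - X l E

namespace SprayAlgebra

variable {ι A : Type*} [Fintype ι] [DecidableEq ι] [CommRing A] [Algebra ℝ A]
  (S : SprayAlgebra ι A)

lemma two_cancel {a b : A} (h : 2 * a = 2 * b) : a = b := by
  have h' : (2 : ℝ) • a = (2 : ℝ) • b := by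
    rwa [two_smul, two_smul, ← two_mul, ← two_mul]
  exact smul_right_injective A (two_ne_zero' ℝ) h'

/-- The nonlinear connection. -/
def N (i j : ι) : A := S.Y j (S.G i)

/-- The Berwald connection coefficients. -/
def Γ (i j k : ι) : A := S.Y j (S.Y k (S.G i))

/-- The horizontal derivation `∂/∂xᵏ - Nʳ_k ∂/∂yʳ`. -/
def δ (k : ι) : Derivation ℝ A A := S.X k - ∑ r, S.N r k • S.Y r

lemma δ_apply (k : ι) (a : A) : S.δ k a = S.X k a - ∑ r, S.N r k * S.Y r a := by
  have : (∑ r, S.N r k • S.Y r) a = ∑ r, S.N r k * S.Y r a := by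
    rw [← Derivation.coeFnAddMonoidHom_apply, map_sum, Finset.sum_apply]; rfl
  rw [δ, Derivation.sub_apply, this]

/-- The curvature of the nonlinear connection. -/
def P (l k r : ι) : A := S.δ l (S.N r k) - S.δ k (S.N r l)

lemma Γ_symm (i j k : ι) : S.Γ i j k = S.Γ i k j := S.YY _ _ _

lemma sum_Y_y_mul (l : ι) (f : ι → A) : ∑ k, S.Y l (S.y k) * f k = f l := by
  simp [S.Y_y]

lemma Y_sum_y_mul (l : ι) (f : ι → A) :
    S.Y l (∑ k, S.y k * f k) = f l + ∑ k, S.y k * S.Y l (f k) := by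
  rw [map_sum, ← S.sum_Y_y_mul l f, ← sum_add_distrib]
  refine sum_congr rfl fun k _ => ?_
  rw [Derivation.leibniz, smul_eq_mul, smul_eq_mul]; ring

lemma X_sum_y_mul (l : ι) (f : ι → A) :
    S.X l (∑ k, S.y k * f k) = ∑ k, S.y k * S.X l (f k) := by
  rw [map_sum]
  refine sum_congr rfl fun k _ => ?_
  rw [Derivation.leibniz, S.X_y]; simp

lemma Y_two_mul (l : ι) (a : A) : S.Y l (2 * a) = 2 * S.Y l a := by
  rw [two_mul, map_add, two_mul]

lemma X_two_mul (l : ι) (a : A) : S.X l (2 * a) = 2 * S.X l a := by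
  rw [two_mul, map_add, two_mul]

lemma euler_Y (l : ι) : ∑ k, S.y k * S.Y l (S.Y k S.E) = S.Y l S.E := by
  have h := congrArg (S.Y l) S.euler
  rw [Y_sum_y_mul, Y_two_mul] at h
  linear_combination h

lemma euler_YY (m l : ι) : ∑ k, S.y k * S.Y m (S.Y l (S.Y k S.E)) = 0 := by
  have h := congrArg (S.Y m) (S.euler_Y l)
  rw [Y_sum_y_mul] at h
  rw [S.YY m l S.E] at h
  linear_combination h

lemma euler_X (m : ι) : ∑ k, S.y k * S.X m (S.Y k S.E) = 2 * S.X m S.E := by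
  have h := congrArg (S.X m) S.euler
  rwa [X_sum_y_mul, X_two_mul] at h

lemma euler_XY (m l : ι) : ∑ k, S.y k * S.X m (S.Y l (S.Y k S.E)) = S.X m (S.Y l S.E) := by
  have h := congrArg (S.X m) (S.euler_Y l)
  rwa [X_sum_y_mul] at h

lemma spray_contract : ∑ i, 2 * S.G i * S.Y i S.E = ∑ k, S.y k * S.X k S.E := by
  have h : ∑ l, S.y l * ∑ i, S.Y l (S.Y i S.E) * (2 * S.G i) =
      ∑ l, S.y l * (∑ k, S.y k * S.X k (S.Y l S.E) - S.X l S.E) :=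
    sum_congr rfl fun l _ => by rw [S.spray l]
  have h1 : ∑ l, S.y l * ∑ i, S.Y l (S.Y i S.E) * (2 * S.G i) = ∑ i, 2 * S.G i * S.Y i S.E := by
    simp_rw [mul_sum]
    rw [sum_comm]
    refine sum_congr rfl fun i _ => ?_
    conv_rhs => rw [← S.euler_Y i, mul_sum]
    refine sum_congr rfl fun k _ => ?_
    rw [S.YY i k]; ring
  have h2 : ∑ l, S.y l * ∑ k, S.y k * S.X k (S.Y l S.E) = 2 * ∑ k, S.y k * S.X k S.E := by
    simp_rw [mul_sum]
    rw [sum_comm]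
    refine sum_congr rfl fun k _ => ?_
    have := S.euler_X k
    calc _ = S.y k * ∑ l, S.y l * S.X k (S.Y l S.E) := by
          rw [mul_sum]; exact sum_congr rfl fun _ _ => by ring
      _ = _ := by rw [this]; ring
  simp_rw [mul_sub, sum_sub_distrib] at h
  rw [h1, h2] at h
  linear_combination h

/-- The energy is horizontally constant. -/
lemma δ_E (k : ι) : S.δ k S.E = 0 := by
  have h := congrArg (S.Y k) S.spray_contract
  rw [Y_sum_y_mul, map_sum] at h
  have h1 : ∑ i, S.Y k (2 * S.G i * S.Y i S.E) =
      ∑ i, S.Y k (S.Y i S.E) * (2 * S.G i) + 2 * ∑ r, S.N r k * S.Y r S.E := by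
    rw [mul_sum, ← sum_add_distrib]
    refine sum_congr rfl fun i _ => ?_
    rw [Derivation.leibniz, Y_two_mul, smul_eq_mul, smul_eq_mul, N]; ring
  rw [h1, S.spray k] at h
  simp_rw [← S.XY] at h
  rw [δ_apply]
  apply two_cancel
  linear_combination -h

/-- The spray coefficients are homogeneous of degree two. -/
lemma euler_G (i : ι) : ∑ k, S.y k * S.N i k = 2 * S.G i := by
  refine sub_eq_zero.1 (S.nondegenerate (fun i => ∑ k, S.y k * S.N i k - 2 * S.G i) ?_ i)
  intro l
  apply two_cancel
  have h : ∑ m, S.y m * S.Y m (∑ i, S.Y l (S.Y i S.E) * (2 * S.G i)) =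
      ∑ m, S.y m * S.Y m (∑ k, S.y k * S.X k (S.Y l S.E) - S.X l S.E) := by
    rw [S.spray l]
  have h1 : ∑ m, S.y m * S.Y m (∑ i, S.Y l (S.Y i S.E) * (2 * S.G i)) =
      2 * ∑ i, S.Y l (S.Y i S.E) * ∑ k, S.y k * S.N i k := by
    calc _ = ∑ i, ∑ m, (S.y m * S.Y l (S.Y i (S.Y m S.E)) * (2 * S.G i) +
          2 * (S.Y l (S.Y i S.E) * (S.y m * S.N i m))) := by
          rw [sum_comm]
          refine sum_congr rfl fun m _ => ?_
          rw [map_sum, mul_sum]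
          refine sum_congr rfl fun i _ => ?_
          rw [Derivation.leibniz, Y_two_mul, smul_eq_mul, smul_eq_mul, N, S.YY i m, S.YY l m]
          ring
      _ = _ := by
          rw [mul_sum]
          refine sum_congr rfl fun i _ => ?_
          rw [sum_add_distrib, ← sum_mul, S.euler_YY, ← mul_sum, ← mul_sum]; ring
  have h2 : ∑ m, S.y m * S.Y m (∑ k, S.y k * S.X k (S.Y l S.E) - S.X l S.E) =
      2 * (∑ k, S.y k * S.X k (S.Y l S.E) - S.X l S.E) := by
    have e : ∑ m, S.y m * ∑ k, S.y k * S.Y m (S.X k (S.Y l S.E)) =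
        ∑ k, S.y k * S.X k (S.Y l S.E) := by
      simp_rw [mul_sum]
      rw [sum_comm]
      refine sum_congr rfl fun k _ => ?_
      conv_rhs => rw [← S.euler_XY k l, mul_sum]
      refine sum_congr rfl fun m _ => ?_
      rw [← S.XY, S.YY m l]; ring
    have e' : ∑ m, S.y m * S.Y m (S.X l S.E) = 2 * S.X l S.E := by
      rw [← S.euler_X]; simp_rw [S.XY]
    simp_rw [map_sub, Y_sum_y_mul, mul_sub, mul_add, sum_sub_distrib, sum_add_distrib]
    rw [e, e']; ring
  rw [h1, h2, ← S.spray l] at h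
  simp_rw [mul_sub, sum_sub_distrib]
  rw [mul_sub, h]; ring

lemma euler_N (i j : ι) : ∑ k, S.y k * S.Γ i j k = S.N i j := by
  have h := congrArg (S.Y j) (S.euler_G i)
  rw [Y_sum_y_mul, Y_two_mul] at h
  simp only [Γ, N] at *
  linear_combination h

lemma euler_Γ (i l j : ι) : ∑ k, S.y k * S.Y l (S.Γ i j k) = 0 := by
  have h := congrArg (S.Y l) (S.euler_N i j)
  rw [Y_sum_y_mul] at h
  have e : S.Y l (S.N i j) = S.Γ i j l := S.YY _ _ _
  linear_combination h + e

lemma euler_B (i m l j : ι) :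
    ∑ k, S.y k * S.Y m (S.Y l (S.Γ i j k)) = - S.Y l (S.Γ i j m) := by
  have h := congrArg (S.Y m) (S.euler_Γ i l j)
  rw [Y_sum_y_mul, map_zero] at h
  linear_combination h

lemma Y_δ (j k : ι) (a : A) :
    S.Y j (S.δ k a) = S.δ k (S.Y j a) - ∑ r, S.Γ r j k * S.Y r a := by
  simp only [δ_apply, map_sub, map_sum, Derivation.leibniz, smul_eq_mul, sum_add_distrib]
  simp_rw [S.XY, S.YY j _ a, Γ, N, mul_comm (S.Y _ a)]
  ring

lemma δ_comm (l k : ι) (a : A) :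
    S.δ l (S.δ k a) - S.δ k (S.δ l a) = - ∑ r, S.P l k r * S.Y r a := by
  have h (l k : ι) : S.δ l (S.δ k a) = S.X l (S.X k a) - ∑ s, S.N s l * S.X k (S.Y s a)
      - ∑ r, S.N r k * S.X l (S.Y r a) + ∑ r, ∑ s, S.N r k * (S.N s l * S.Y s (S.Y r a))
      - ∑ r, S.δ l (S.N r k) * S.Y r a := by
    rw [S.δ_apply k, map_sub, map_sum]
    simp_rw [Derivation.leibniz, smul_eq_mul, sum_add_distrib, S.δ_apply l (S.X k a),
      S.δ_apply l (S.Y _ a), mul_sub, sum_sub_distrib, S.XY, mul_sum, mul_comm (S.Y _ a)]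
    ring
  rw [h l k, h k l, S.XX l k]
  simp_rw [P, sub_mul, sum_sub_distrib]
  have : ∑ r, ∑ s, S.N r k * (S.N s l * S.Y s (S.Y r a)) =
      ∑ r, ∑ s, S.N r l * (S.N s k * S.Y s (S.Y r a)) := by
    rw [sum_comm]
    refine sum_congr rfl fun r _ => sum_congr rfl fun s _ => ?_
    rw [S.YY r s]; ring
  rw [this]; ring

lemma sum_P_mul (l k : ι) : ∑ r, S.P l k r * S.Y r S.E = 0 := by
  have h := S.δ_comm l k S.E
  rw [δ_E, δ_E, map_zero, map_zero, sub_zero] at h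
  linear_combination h

lemma δ_Y_E (k j : ι) : S.δ k (S.Y j S.E) = ∑ r, S.Γ r j k * S.Y r S.E := by
  have h := S.Y_δ j k S.E
  rw [δ_E, map_zero] at h
  linear_combination -h

lemma δ_YY_E (k i j : ι) : S.δ k (S.Y i (S.Y j S.E)) =
    ∑ r, S.Γ r i k * S.Y r (S.Y j S.E) + ∑ r, S.Γ r j k * S.Y i (S.Y r S.E)
      + ∑ r, S.Y i (S.Γ r j k) * S.Y r S.E := by
  have h := S.Y_δ i k (S.Y j S.E)
  rw [δ_Y_E, map_sum] at h
  simp_rw [Derivation.leibniz, smul_eq_mul, sum_add_distrib, mul_comm (S.Y _ S.E)] at h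
  linear_combination -h

lemma δ_YYY_E (k l i j : ι) : S.δ k (S.Y l (S.Y i (S.Y j S.E))) =
    ∑ r, S.Γ r l k * S.Y r (S.Y i (S.Y j S.E))
      + ∑ r, S.Γ r i k * S.Y l (S.Y r (S.Y j S.E)) + ∑ r, S.Γ r j k * S.Y l (S.Y i (S.Y r S.E))
      + ∑ r, S.Y l (S.Γ r i k) * S.Y r (S.Y j S.E) + ∑ r, S.Y l (S.Γ r j k) * S.Y i (S.Y r S.E)
      + ∑ r, S.Y i (S.Γ r j k) * S.Y l (S.Y r S.E)
      + ∑ r, S.Y l (S.Y i (S.Γ r j k)) * S.Y r S.E := by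
  have h := S.Y_δ l k (S.Y i (S.Y j S.E))
  rw [δ_YY_E, map_add, map_add, map_sum, map_sum, map_sum] at h
  simp_rw [Derivation.leibniz, smul_eq_mul, sum_add_distrib, mul_comm (S.Y _ _) (S.Y _ (S.Γ _ _ _)),
    mul_comm (S.Y _ S.E)] at h
  linear_combination -h

/-- The horizontal covariant derivative of a covariant 3-tensor. -/
def hD (T : ι → ι → ι → A) (i j k m : ι) : A :=
  S.δ m (T i j k) - ∑ r, T r j k * S.Γ r i m - ∑ r, T i r k * S.Γ r j m - ∑ r, T i j r * S.Γ r k m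

lemma hD_smul (c : ℝ) (T : ι → ι → ι → A) (i j k m : ι) :
    S.hD (fun i j k => c • T i j k) i j k m = c • S.hD T i j k m := by
  simp only [hD, Derivation.map_smul, smul_mul_assoc, ← smul_sum, smul_sub]

/-- Four times the Landsberg curvature. -/
def L (i j k : ι) : A := ∑ m, S.hD (fun i j k => S.Y i (S.Y j (S.Y k S.E))) i j k m * S.y m

lemma sum_sum_mul_y (f : ι → ι → A) (c : ι → A) (h : ∀ r, ∑ k, S.y k * f r k = c r)
    (a : ι → A) : ∑ k, (∑ r, f r k * a r) * S.y k = ∑ r, c r * a r := by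
  simp_rw [sum_mul]
  rw [sum_comm]
  refine sum_congr rfl fun r _ => ?_
  rw [← h r, sum_mul]
  exact sum_congr rfl fun k _ => by ring

lemma L_eq (i j k : ι) : S.L i j k = - ∑ r, S.Y i (S.Γ r j k) * S.Y r S.E := by
  have h (m : ι) : S.hD (fun i j k => S.Y i (S.Y j (S.Y k S.E))) i j k m =
      ∑ r, S.Y i (S.Γ r j m) * S.Y r (S.Y k S.E) + ∑ r, S.Y i (S.Γ r k m) * S.Y j (S.Y r S.E)
      + ∑ r, S.Y j (S.Γ r k m) * S.Y i (S.Y r S.E)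
      + ∑ r, S.Y i (S.Y j (S.Γ r k m)) * S.Y r S.E := by
    simp only [hD, δ_YYY_E, mul_comm _ (S.Γ _ _ _)]
    ring
  simp_rw [L, h, add_mul, sum_add_distrib]
  rw [S.sum_sum_mul_y _ _ (fun r => S.euler_Γ r i j), S.sum_sum_mul_y _ _ (fun r => S.euler_Γ r i k),
    S.sum_sum_mul_y _ _ (fun r => S.euler_Γ r j k), S.sum_sum_mul_y _ _ (fun r => S.euler_B r i j k)]
  have (r : ι) : S.Y j (S.Γ r k i) = S.Y i (S.Γ r j k) := by
    simp only [Γ]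
    rw [S.YY k i, S.YY j i]
  simp [this]

lemma L_eq_neg_hD (i j k : ι) : S.L i j k = - (S.δ k (S.Y i (S.Y j S.E))
    - ∑ r, S.Γ r i k * S.Y r (S.Y j S.E) - ∑ r, S.Γ r j k * S.Y i (S.Y r S.E)) := by
  rw [L_eq, δ_YY_E]; ring

lemma Y_P (i l k r : ι) : S.Y i (S.P l k r) =
    S.δ l (S.Γ r i k) - S.δ k (S.Γ r i l) - ∑ s, S.Γ s i l * S.Γ r s k
      + ∑ s, S.Γ s i k * S.Γ r s l := by
  rw [P, map_sub, Y_δ, Y_δ]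
  simp only [N, Γ]
  ring

lemma hD_L_sub (i j k l : ι) : S.hD S.L i j k l - S.hD S.L i j l k =
    ∑ r, S.P l k r * S.Y r (S.Y i (S.Y j S.E)) + ∑ r, S.Y i (S.P l k r) * S.Y r (S.Y j S.E)
      + ∑ r, S.Y j (S.P l k r) * S.Y i (S.Y r S.E) := by
  have hsym (k l : ι) : ∑ r, S.L i j r * S.Γ r k l = ∑ r, S.L i j r * S.Γ r l k := by
    simp_rw [S.Γ_symm _ k l]
  have hc := S.δ_comm l k (S.Y i (S.Y j S.E))
  have cross (k l : ι) : ∑ r, (∑ s, S.Γ s j k * S.Y r (S.Y s S.E)) * S.Γ r i l =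
      ∑ r, (∑ s, S.Γ s i l * S.Y s (S.Y r S.E)) * S.Γ r j k := by
    simp_rw [sum_mul]
    rw [sum_comm]
    exact sum_congr rfl fun r _ => sum_congr rfl fun s _ => by ring
  have diag₁ (k l : ι) : ∑ r, (∑ s, S.Γ s r k * S.Y s (S.Y j S.E)) * S.Γ r i l =
      ∑ r, (∑ s, S.Γ s i l * S.Γ r s k) * S.Y r (S.Y j S.E) := by
    simp_rw [sum_mul]
    rw [sum_comm]
    exact sum_congr rfl fun r _ => sum_congr rfl fun s _ => by ring
  have diag₂ (k l : ι) : ∑ r, (∑ s, S.Γ s r k * S.Y i (S.Y s S.E)) * S.Γ r j l =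
      ∑ r, (∑ s, S.Γ s j l * S.Γ r s k) * S.Y i (S.Y r S.E) := by
    simp_rw [sum_mul]
    rw [sum_comm]
    exact sum_congr rfl fun r _ => sum_congr rfl fun s _ => by ring
  have expand (k l : ι) : S.hD S.L i j k l = - S.δ l (S.δ k (S.Y i (S.Y j S.E)))
      + ∑ r, S.δ l (S.Γ r i k) * S.Y r (S.Y j S.E) + ∑ r, S.Γ r i k * S.δ l (S.Y r (S.Y j S.E))
      + ∑ r, S.δ l (S.Γ r j k) * S.Y i (S.Y r S.E) + ∑ r, S.Γ r j k * S.δ l (S.Y i (S.Y r S.E))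
      + ∑ r, S.Γ r i l * S.δ k (S.Y r (S.Y j S.E)) + ∑ r, S.Γ r j l * S.δ k (S.Y i (S.Y r S.E))
      - ∑ r, (∑ s, S.Γ s r k * S.Y s (S.Y j S.E)) * S.Γ r i l
      - ∑ r, (∑ s, S.Γ s j k * S.Y r (S.Y s S.E)) * S.Γ r i l
      - ∑ r, (∑ s, S.Γ s i k * S.Y s (S.Y r S.E)) * S.Γ r j l
      - ∑ r, (∑ s, S.Γ s r k * S.Y i (S.Y s S.E)) * S.Γ r j l
      - ∑ r, S.L i j r * S.Γ r k l := by
    have e₁ : ∑ r, S.L r j k * S.Γ r i l = - ∑ r, S.Γ r i l * S.δ k (S.Y r (S.Y j S.E))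
        + ∑ r, (∑ s, S.Γ s r k * S.Y s (S.Y j S.E)) * S.Γ r i l
        + ∑ r, (∑ s, S.Γ s j k * S.Y r (S.Y s S.E)) * S.Γ r i l := by
      rw [← sum_neg_distrib, ← sum_add_distrib, ← sum_add_distrib]
      exact sum_congr rfl fun r _ => by rw [L_eq_neg_hD]; ring
    have e₂ : ∑ r, S.L i r k * S.Γ r j l = - ∑ r, S.Γ r j l * S.δ k (S.Y i (S.Y r S.E))
        + ∑ r, (∑ s, S.Γ s i k * S.Y s (S.Y r S.E)) * S.Γ r j l
        + ∑ r, (∑ s, S.Γ s r k * S.Y i (S.Y s S.E)) * S.Γ r j l := by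
      rw [← sum_neg_distrib, ← sum_add_distrib, ← sum_add_distrib]
      exact sum_congr rfl fun r _ => by rw [L_eq_neg_hD]; ring
    rw [hD, e₁, e₂, L_eq_neg_hD S i j k, map_neg, map_sub, map_sub, map_sum, map_sum]
    simp_rw [Derivation.leibniz, smul_eq_mul, sum_add_distrib, mul_comm (S.Y _ _) (S.δ _ _)]
    ring
  rw [expand k l, expand l k, hsym l k, cross k l, cross l k, diag₁, diag₁, diag₂, diag₂]
  simp_rw [Y_P, add_mul, sub_mul, sum_add_distrib, sum_sub_distrib]
  linear_combination -hc

/-- If the curvature of the nonlinear connection is linear in the fibre coordinates, the stretch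
curvature vanishes. -/
theorem hD_L_symm (hP : ∀ i j l k r, S.Y i (S.Y j (S.P l k r)) = 0) (i j k l : ι) :
    S.hD S.L i j k l = S.hD S.L i j l k := by
  rw [← sub_eq_zero, hD_L_sub]
  have h := congrArg (fun a => S.Y i (S.Y j a)) (S.sum_P_mul l k)
  simp only [map_sum, Derivation.leibniz, smul_eq_mul, map_add, sum_add_distrib, map_zero, hP,
    mul_zero, sum_const_zero] at h
  have e₁ (r : ι) : S.Y r (S.Y i (S.Y j S.E)) = S.Y i (S.Y j (S.Y r S.E)) := by
    rw [S.YY r i, S.YY r j]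
  have e₂ (r : ι) : S.Y r (S.Y j S.E) = S.Y j (S.Y r S.E) := S.YY _ _ _
  simp_rw [e₁, e₂, mul_comm (S.Y i (S.P _ _ _))]
  linear_combination h

/-- The Riemann curvature `Rⁱ_k`. -/
def R (i k : ι) : A := 2 * S.X k (S.G i) - ∑ j, S.y j * S.X j (S.N i k)
  + 2 * ∑ j, S.G j * S.Γ i j k - ∑ j, S.N i j * S.N j k

lemma Y_R_sub (i k l : ι) : S.Y l (S.R i k) - S.Y k (S.R i l) = 3 * S.P k l i := by
  have h (k l : ι) : S.Y l (S.R i k) = 2 * S.X k (S.N i l) - S.X l (S.N i k)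
      - ∑ j, S.y j * S.X j (S.Γ i l k) + 2 * ∑ j, S.N j l * S.Γ i j k
      + 2 * ∑ j, S.G j * S.Y j (S.Γ i l k) - ∑ j, S.N j k * S.Γ i l j
      - ∑ j, S.N i j * S.Γ j l k := by
    simp only [R, map_sub, map_add, Y_two_mul, Y_sum_y_mul]
    simp only [map_sum, Derivation.leibniz, smul_eq_mul, sum_add_distrib, ← S.XY]
    have e (j : ι) : S.Y l (S.Γ i j k) = S.Y j (S.Γ i l k) := S.YY _ _ _
    simp only [e]
    simp only [N, Γ, mul_comm (S.Y _ (S.Y _ _)) (S.Y _ _)]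
    ring
  rw [h k l, h l k, P, δ_apply, δ_apply]
  simp_rw [S.Γ_symm _ l k]
  have e (j k : ι) : S.Γ i j k = S.Y j (S.N i k) := rfl
  simp_rw [S.Γ_symm i k _, S.Γ_symm i l _, e]
  ring

end SprayAlgebra

end SprayAlgebra

section SmoothAlgebra

open TopologicalSpace

variable {V : Type*} [NormedAddCommGroup V] [NormedSpace ℝ V]

/-- The algebra of smooth real functions on an open subset of a normed space. -/
def smoothAlgebra (s : Opens V) : Subalgebra ℝ (s → ℝ) where
  carrier := {f | ∃ g : V → ℝ, ContDiffOn ℝ (⊤ : ℕ∞) g s ∧ ∀ p : s, g p = f p}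
  mul_mem' := by
    rintro _ _ ⟨g, hg, hg'⟩ ⟨h, hh, hh'⟩
    exact ⟨fun p => g p * h p, hg.mul hh, fun p => by simp [hg', hh']⟩
  add_mem' := by
    rintro _ _ ⟨g, hg, hg'⟩ ⟨h, hh, hh'⟩
    exact ⟨fun p => g p + h p, hg.add hh, fun p => by simp [hg', hh']⟩
  algebraMap_mem' c := ⟨fun _ => c, contDiffOn_const, fun _ => rfl⟩

namespace smoothAlgebra

variable {s : Opens V}

/-- Evaluation at a point. -/
def ev (p : s) : smoothAlgebra s →ₐ[ℝ] ℝ := (Pi.evalAlgHom ℝ (fun _ : s => ℝ) p).comp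
  (smoothAlgebra s).val

lemma ext_ev {a b : smoothAlgebra s} (h : ∀ p, ev p a = ev p b) : a = b :=
  Subtype.ext (funext h)

lemma exists_rep (a : smoothAlgebra s) :
    ∃ g : V → ℝ, ContDiffOn ℝ (⊤ : ℕ∞) g s ∧ ∀ p : s, g p = ev p a := a.2

lemma exists_ev_eq {g : V → ℝ} (hg : ContDiffOn ℝ (⊤ : ℕ∞) g s) :
    ∃ a : smoothAlgebra s, ∀ p : s, g p = ev p a := ⟨⟨fun p => g p, g, hg, fun _ => rfl⟩, fun _ => rfl⟩

lemma contDiffOn_of_ev {g : V → ℝ} {a : smoothAlgebra s} (h : ∀ p : s, g p = ev p a) :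
    ContDiffOn ℝ (⊤ : ℕ∞) g s := by
  obtain ⟨g', hg', h'⟩ := exists_rep a
  exact hg'.congr fun p hp => by rw [h ⟨p, hp⟩, ← h' ⟨p, hp⟩]

lemma differentiableAt_of_ev {g : V → ℝ} {a : smoothAlgebra s} (h : ∀ p : s, g p = ev p a)
    (p : s) : DifferentiableAt ℝ g p :=
  ((contDiffOn_of_ev h).contDiffAt (s.isOpen.mem_nhds p.2)).differentiableAt (by simp)

lemma exists_fderiv (a : smoothAlgebra s) (v : V) : ∃ b : smoothAlgebra s, ∀ g : V → ℝ,
    (∀ p : s, g p = ev p a) → ∀ p : s, fderiv ℝ g p v = ev p b := by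
  obtain ⟨g, hg, h⟩ := exists_rep a
  have hd : ContDiffOn ℝ (⊤ : ℕ∞) (fun p => fderiv ℝ g p v) s :=
    (hg.fderiv_of_isOpen s.isOpen (m := (⊤ : ℕ∞)) (by simp)).clm_apply contDiffOn_const
  obtain ⟨b, hb⟩ := exists_ev_eq hd
  refine ⟨b, fun g' h' p => ?_⟩
  have : g' =ᶠ[nhds (p : V)] g := by
    filter_upwards [s.isOpen.mem_nhds p.2] with q hq
    rw [h' ⟨q, hq⟩, h ⟨q, hq⟩]
  rw [this.fderiv_eq, hb]

/-- The directional derivative of a smooth function, as a smooth function. -/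
noncomputable def dirDeriv (v : V) (a : smoothAlgebra s) : smoothAlgebra s :=
  (exists_fderiv a v).choose

lemma fderiv_eq {g : V → ℝ} {a : smoothAlgebra s} (h : ∀ p : s, g p = ev p a) (v : V) (p : s) :
    fderiv ℝ g p v = ev p (dirDeriv v a) := (exists_fderiv a v).choose_spec g h p

/-- The directional derivative as a derivation. -/
noncomputable def D (v : V) : Derivation ℝ (smoothAlgebra s) (smoothAlgebra s) :=
  Derivation.mk'
    { toFun := dirDeriv v
      map_add' := fun a b => ext_ev fun p => by
        obtain ⟨g, -, h⟩ := exists_rep a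
        obtain ⟨g', -, h'⟩ := exists_rep b
        rw [← fderiv_eq (g := fun q => g q + g' q) (fun p => by simp [h, h']), map_add,
          ← fderiv_eq h, ← fderiv_eq h',
          fderiv_fun_add (differentiableAt_of_ev h p) (differentiableAt_of_ev h' p)]
        rfl
      map_smul' := fun c a => ext_ev fun p => by
        obtain ⟨g, -, h⟩ := exists_rep a
        rw [← fderiv_eq (g := fun q => c * g q) (fun p => by simp [h]), RingHom.id_apply, map_smul,
          ← fderiv_eq h, fderiv_const_mul (differentiableAt_of_ev h p)]
        rfl }
    fun a b => ext_ev fun p => by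
      obtain ⟨g, -, h⟩ := exists_rep a
      obtain ⟨g', -, h'⟩ := exists_rep b
      simp only [LinearMap.coe_mk, AddHom.coe_mk]
      rw [← fderiv_eq (g := fun q => g q * g' q) (fun p => by simp [h, h']), map_add, smul_eq_mul,
        smul_eq_mul, map_mul, map_mul, ← fderiv_eq h, ← fderiv_eq h',
        fderiv_fun_mul (differentiableAt_of_ev h p) (differentiableAt_of_ev h' p), ← h, ← h']
      rfl

lemma fderiv_eq_D {g : V → ℝ} {a : smoothAlgebra s} (h : ∀ p : s, g p = ev p a) (v : V) (p : s) :
    fderiv ℝ g p v = ev p (D v a) := fderiv_eq h v p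

lemma D_comm (v w : V) (a : smoothAlgebra s) : D v (D w a) = D w (D v a) := by
  obtain ⟨g, hg, h⟩ := exists_rep a
  refine ext_ev fun p => ?_
  have hga : ContDiffAt ℝ (⊤ : ℕ∞) g p := hg.contDiffAt (s.isOpen.mem_nhds p.2)
  have hd : DifferentiableAt ℝ (fderiv ℝ g) p :=
    (hga.fderiv_right (m := (⊤ : ℕ∞)) (by simp)).differentiableAt (by simp)
  have key (v w : V) : ev p (D v (D w a)) = fderiv ℝ (fderiv ℝ g) p v w := by
    rw [← fderiv_eq_D (g := fun q => fderiv ℝ g q w) (fun p => fderiv_eq_D h w p),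
      fderiv_clm_apply hd (by fun_prop)]
    simp
  rw [key, key]
  exact (hga.isSymmSndFDerivAt (by simpa using WithTop.coe_le_coe.2 (le_top : (2 : ℕ∞) ≤ ⊤))).eq v w

lemma exists_inv {a : smoothAlgebra s} (ha : ∀ p, ev p a ≠ 0) :
    ∃ b, ∀ p, ev p b = (ev p a)⁻¹ := by
  obtain ⟨g, hg, h⟩ := exists_rep a
  obtain ⟨b, hb⟩ := exists_ev_eq (hg.inv fun p hp => by rw [h ⟨p, hp⟩]; exact ha _)
  exact ⟨b, fun p => by rw [← hb, ← h, Pi.inv_apply]⟩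

lemma exists_matrix_inv {ι : Type*} [Fintype ι] [DecidableEq ι] (M : Matrix ι ι (smoothAlgebra s))
    (hM : ∀ p, (M.map (ev p)).det ≠ 0) :
    ∃ M' : Matrix ι ι (smoothAlgebra s), ∀ p, M'.map (ev p) = (M.map (ev p))⁻¹ := by
  have hdet (p : s) : ev p M.det = (M.map (ev p)).det := AlgHom.map_det _ _
  obtain ⟨d, hd⟩ := exists_inv (a := M.det) fun p => by rw [hdet]; exact hM p
  refine ⟨d • M.adjugate, fun p => ?_⟩
  have hadj : (M.adjugate).map (ev p) = (M.map (ev p)).adjugate := AlgHom.map_adjugate (ev p) M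
  rw [Matrix.inv_def, Ring.inverse_eq_inv', ← hadj, ← hdet, ← hd]
  ext i j
  simp

end smoothAlgebra

end SmoothAlgebra

section Represents

open TopologicalSpace smoothAlgebra

variable {n : ℕ} {s : Opens (Pt n × Pt n)}

/-- A function of `(x, y)` agrees on `s` with an element of the algebra of smooth functions. -/
def Represents (f : Pt n → Pt n → ℝ) (a : smoothAlgebra s) : Prop :=
  ∀ p : s, f p.1.1 p.1.2 = ev p a

namespace Represents

variable {f g : Pt n → Pt n → ℝ} {a b : smoothAlgebra s}

lemma pdx (h : Represents f a) (i : Fin n) : Represents (pdx f i) (D (Pi.single i 1, 0) a) := by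
  intro p
  rw [← fderiv_eq_D (g := Function.uncurry f) h]
  have hd := (differentiableAt_of_ev (g := Function.uncurry f) h p).hasFDerivAt
  have hc : HasFDerivAt (fun x' : Pt n => (x', p.1.2)) (ContinuousLinearMap.inl ℝ (Pt n) (Pt n))
    p.1.1 := hasFDerivAt_prodMk_left _ _
  have := HasFDerivAt.comp (g := Function.uncurry f) p.1.1 hd hc
  exact congrArg (fun T => T (Pi.single i 1)) this.fderiv

lemma pdy (h : Represents f a) (i : Fin n) : Represents (pdy f i) (D (0, Pi.single i 1) a) := by
  intro p
  rw [← fderiv_eq_D (g := Function.uncurry f) h]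
  have hd := (differentiableAt_of_ev (g := Function.uncurry f) h p).hasFDerivAt
  have hc : HasFDerivAt (fun y' : Pt n => (p.1.1, y')) (ContinuousLinearMap.inr ℝ (Pt n) (Pt n))
    p.1.2 := hasFDerivAt_prodMk_right _ _
  have := HasFDerivAt.comp (g := Function.uncurry f) p.1.2 hd hc
  exact congrArg (fun T => T (Pi.single i 1)) this.fderiv

lemma differentiableAt_fiber (h : Represents f a) (p : s) :
    DifferentiableAt ℝ (fun y' => f p.1.1 y') p.1.2 := by
  have hd := (differentiableAt_of_ev (g := Function.uncurry f) h p).hasFDerivAt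
  have hc : HasFDerivAt (fun y' : Pt n => (p.1.1, y')) (ContinuousLinearMap.inr ℝ (Pt n) (Pt n))
    p.1.2 := hasFDerivAt_prodMk_right _ _
  exact (HasFDerivAt.comp (g := Function.uncurry f) p.1.2 hd hc).differentiableAt

lemma add (h : Represents f a) (h' : Represents g b) :
    Represents (fun x y => f x y + g x y) (a + b) := fun p => by rw [map_add, ← h, ← h']

lemma sub (h : Represents f a) (h' : Represents g b) :
    Represents (fun x y => f x y - g x y) (a - b) := fun p => by rw [map_sub, ← h, ← h']

lemma mul (h : Represents f a) (h' : Represents g b) :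
    Represents (fun x y => f x y * g x y) (a * b) := fun p => by rw [map_mul, ← h, ← h']

lemma two_mul (h : Represents f a) : Represents (fun x y => 2 * f x y) (2 * a) :=
  fun p => by rw [map_mul, ← h, map_ofNat]

lemma const_mul (c : ℝ) (h : Represents f a) : Represents (fun x y => c * f x y) (c • a) :=
  fun p => by rw [map_smul, ← h, smul_eq_mul]

lemma sum {f : Fin n → Pt n → Pt n → ℝ} {a : Fin n → smoothAlgebra s}
    (h : ∀ i, Represents (f i) (a i)) : Represents (fun x y => ∑ i, f i x y) (∑ i, a i) :=
  fun p => by rw [map_sum]; exact Finset.sum_congr rfl fun i _ => h i p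

end Represents

end Represents

section Finsler

open TopologicalSpace smoothAlgebra

variable {n : ℕ} {U : Set (Pt n)} {F : Pt n → Pt n → ℝ}

/-- The slit tangent bundle over `U`. -/
def IsFinslerMetric.slit (hF : IsFinslerMetric U F) : Opens (Pt n × Pt n) :=
  ⟨U ×ˢ {y : Pt n | y ≠ 0}, hF.isOpen.prod isOpen_ne⟩

lemma IsFinslerMetric.euler (hF : IsFinslerMetric U F) {x y : Pt n} (hx : x ∈ U) (hy : y ≠ 0)
    (hd : DifferentiableAt ℝ (fun y' => F2 F x y') y) :
    ∑ k, y k * pdy (F2 F) k x y = 2 * F2 F x y := by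
  have h₁ : HasDerivAt (fun t : ℝ => F2 F x (t • y)) (fderiv ℝ (fun y' => F2 F x y') y y) 1 := by
    have hl : HasDerivAt (fun t : ℝ => t • y) y 1 := by
      simpa using (hasDerivAt_id (1 : ℝ)).smul_const y
    have hd' : HasFDerivAt (fun y' => F2 F x y') (fderiv ℝ (fun y' => F2 F x y') y)
        ((1 : ℝ) • y) := by rw [one_smul]; exact hd.hasFDerivAt
    exact hd'.comp_hasDerivAt 1 hl
  have h₂ : HasDerivAt (fun t : ℝ => F2 F x (t • y)) (2 * F2 F x y) 1 := by
    have : HasDerivAt (fun t : ℝ => t ^ 2 * F2 F x y) (2 * F2 F x y) 1 := by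
      simpa using (hasDerivAt_pow 2 (1 : ℝ)).mul_const (F2 F x y)
    refine this.congr_of_eventuallyEq ?_
    filter_upwards [lt_mem_nhds (zero_lt_one' ℝ)] with t ht
    simp only [F2]
    rw [hF.homog x hx y hy t ht, mul_pow]
  rw [← h₁.unique h₂]
  have h₃ := congrArg (fderiv ℝ (fun y' => F2 F x y') y) (pi_eq_sum_univ' y)
  simp only [map_sum, map_smul, smul_eq_mul] at h₃
  exact h₃.symm

/-- The data of the algebraic model representing those of a Finsler metric. -/
structure SprayModel (hF : IsFinslerMetric U F) where
  alg : SprayAlgebra (Fin n) (smoothAlgebra hF.slit)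
  X_eq : ∀ i, alg.X i = D (Pi.single i 1, 0)
  Y_eq : ∀ i, alg.Y i = D (0, Pi.single i 1)
  y_rep : ∀ i, Represents (fun _ y => y i) (alg.y i)
  E_rep : Represents (F2 F) alg.E
  G_rep : ∀ i, Represents (Gspray F i) (alg.G i)

lemma D_coord (v : Pt n × Pt n) {s : Opens (Pt n × Pt n)} {i : Fin n} {a : smoothAlgebra s}
    (h : Represents (fun _ y => y i) a) : D v a = algebraMap ℝ _ (v.2 i) := by
  refine ext_ev fun p => ?_
  rw [← fderiv_eq_D (g := fun q : Pt n × Pt n => q.2 i) h, AlgHom.commutes]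
  have : HasFDerivAt (fun q : Pt n × Pt n => q.2 i)
      ((ContinuousLinearMap.proj i).comp (ContinuousLinearMap.snd ℝ (Pt n) (Pt n))) (p : Pt n × Pt n) :=
    ContinuousLinearMap.hasFDerivAt (𝕜 := ℝ)
      ((ContinuousLinearMap.proj i).comp (ContinuousLinearMap.snd ℝ (Pt n) (Pt n)))
  rw [this.fderiv]
  rfl

lemma IsFinslerMetric.exists_sprayModel (hF : IsFinslerMetric U F) : Nonempty (SprayModel hF) := by
  obtain ⟨E, hE⟩ : ∃ E : smoothAlgebra hF.slit, Represents (F2 F) E :=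
    exists_ev_eq (s := hF.slit) (g := fun p => F2 F p.1 p.2) (hF.smooth.pow 2)
  have hy (i : Fin n) : ∃ a : smoothAlgebra hF.slit, Represents (fun _ y => y i) a :=
    exists_ev_eq (s := hF.slit) (g := fun p => p.2 i) (by fun_prop)
  choose y hy using hy
  let X (i : Fin n) : Derivation ℝ (smoothAlgebra hF.slit) (smoothAlgebra hF.slit) :=
    D (Pi.single i 1, 0)
  let Y (i : Fin n) : Derivation ℝ (smoothAlgebra hF.slit) (smoothAlgebra hF.slit) :=
    D (0, Pi.single i 1)
  let M : Matrix (Fin n) (Fin n) (smoothAlgebra hF.slit) :=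
    Matrix.of fun i j => (1 / 2 : ℝ) • Y i (Y j E)
  have hM (p : hF.slit) : M.map (ev p) = gMat F p.1.1 p.1.2 := by
    ext i j
    exact (((hE.pdy j).pdy i).const_mul (1 / 2) p).symm
  have hdet (p : hF.slit) : IsUnit (gMat F p.1.1 p.1.2).det :=
    (Matrix.isUnit_iff_isUnit_det _).1 (hF.posdef _ p.2.1 _ p.2.2).isUnit
  obtain ⟨H, hH⟩ := exists_matrix_inv M fun p => by rw [hM]; exact (hdet p).ne_zero
  have hHrep (i j : Fin n) : Represents (gInv F i j) (H i j) := fun p => by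
    rw [gInv, ← hM, ← hH]; rfl
  let Q (l : Fin n) : smoothAlgebra hF.slit := ∑ k, y k * X k (Y l E) - X l E
  let G (i : Fin n) : smoothAlgebra hF.slit := (1 / 4 : ℝ) • ∑ l, H i l * Q l
  have hG (i : Fin n) : Represents (Gspray F i) (G i) :=
    (Represents.sum fun l => (hHrep i l).mul
      ((Represents.sum fun k => (hy k).mul ((hE.pdy l).pdx k)).sub (hE.pdx l))).const_mul _
  have hYY (p : hF.slit) (l i : Fin n) : ev p (Y l (Y i E)) = 2 * M.map (ev p) l i := by
    simp [M]
  refine ⟨⟨{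
    X := X
    Y := Y
    XX := fun _ _ _ => D_comm _ _ _
    XY := fun _ _ _ => D_comm _ _ _
    YY := fun _ _ _ => D_comm _ _ _
    y := y
    X_y := fun i j => by simp [X, D_coord _ (hy j)]
    Y_y := fun i j => by
      by_cases h : i = j
      · subst h; simp [Y, D_coord _ (hy i)]
      · simp [Y, D_coord _ (hy j), h, Ne.symm h]
    E := E
    euler := ?_
    nondegenerate := ?_
    G := G
    spray := ?_ }, fun _ => rfl, fun _ => rfl, hy, hE, hG⟩⟩
  · refine ext_ev fun p => ?_
    have h := hF.euler p.2.1 p.2.2 (hE.differentiableAt_fiber p)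
    rw [← (Represents.sum fun k => (hy k).mul (hE.pdy k)) p, ← hE.two_mul p]
    exact h
  · intro v hv i
    refine ext_ev fun p => ?_
    rw [map_zero]
    refine congrFun (Matrix.eq_zero_of_mulVec_eq_zero (M := M.map (ev p)) (v := fun i => ev p (v i))
      (by rw [hM]; exact (hdet p).ne_zero) (funext fun l => ?_)) i
    have h := congrArg (ev p) (hv l)
    simp only [map_sum, map_mul, map_zero, hYY, mul_assoc, ← Finset.mul_sum] at h
    simpa [Matrix.mulVec, dotProduct] using h
  · intro l
    refine ext_ev fun p => ?_
    have hinv : M.map (ev p) * H.map (ev p) = 1 := by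
      rw [hH]; exact Matrix.mul_nonsing_inv _ (by rw [hM]; exact hdet p)
    have h : (M.map (ev p)).mulVec ((H.map (ev p)).mulVec fun l => ev p (Q l)) =
        fun l => ev p (Q l) := by
      rw [Matrix.mulVec_mulVec, hinv, Matrix.one_mulVec]
    change _ = ev p (Q l)
    rw [← congrFun h l, map_sum]
    simp only [Matrix.mulVec, dotProduct]
    refine Finset.sum_congr rfl fun i _ => ?_
    rw [map_mul, map_mul, hYY]
    simp only [G, map_smul, map_sum, map_mul, map_ofNat, smul_eq_mul, Matrix.map_apply]
    ring

namespace SprayModel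

variable {hF : IsFinslerMetric U F} (S : SprayModel hF)

lemma pdx_rep {f : Pt n → Pt n → ℝ} {a} (h : Represents f a) (i : Fin n) :
    Represents (pdx f i) (S.alg.X i a) := by rw [S.X_eq]; exact h.pdx i

lemma pdy_rep {f : Pt n → Pt n → ℝ} {a} (h : Represents f a) (i : Fin n) :
    Represents (pdy f i) (S.alg.Y i a) := by rw [S.Y_eq]; exact h.pdy i

lemma N_rep (i j : Fin n) : Represents (Ncon F i j) (S.alg.N i j) := S.pdy_rep (S.G_rep i) j

lemma Γ_rep (i j k : Fin n) : Represents (Γcon F i j k) (S.alg.Γ i j k) :=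
  S.pdy_rep (S.pdy_rep (S.G_rep i) k) j

lemma hD0_rep {f : Pt n → Pt n → ℝ} {a} (h : Represents f a) (m : Fin n) :
    Represents (hD0 F f m) (S.alg.δ m a) := by
  rw [SprayAlgebra.δ_apply]
  exact (S.pdx_rep h m).sub (Represents.sum fun r => (S.N_rep r m).mul (S.pdy_rep h r))

lemma hD3_rep {T : Fin n → Fin n → Fin n → Pt n → Pt n → ℝ}
    {T' : Fin n → Fin n → Fin n → smoothAlgebra hF.slit}
    (h : ∀ i j k, Represents (T i j k) (T' i j k)) (i j k m : Fin n) :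
    Represents (hD3 F T i j k m) (S.alg.hD T' i j k m) :=
  (((S.hD0_rep (h i j k) m).sub (Represents.sum fun r => (h r j k).mul (S.Γ_rep r i m))).sub
    (Represents.sum fun r => (h i r k).mul (S.Γ_rep r j m))).sub
    (Represents.sum fun r => (h i j r).mul (S.Γ_rep r k m))

lemma Cartan_rep (i j k : Fin n) : Represents (Cartan F i j k)
    ((1 / 4 : ℝ) • S.alg.Y i (S.alg.Y j (S.alg.Y k S.alg.E))) :=
  (S.pdy_rep (S.pdy_rep (S.pdy_rep S.E_rep k) j) i).const_mul _

lemma Land_rep (i j k : Fin n) : Represents (Land F i j k) ((1 / 4 : ℝ) • S.alg.L i j k) := by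
  have h : Represents (Land F i j k) _ :=
    Represents.sum fun m => (S.hD3_rep S.Cartan_rep i j k m).mul (S.y_rep m)
  rw [SprayAlgebra.L, Finset.smul_sum]
  simpa only [SprayAlgebra.hD_smul, smul_mul_assoc] using h

lemma RiemK_rep (i k : Fin n) : Represents (RiemK F i k) (S.alg.R i k) :=
  (((S.pdx_rep (S.G_rep i) k).two_mul.sub
    (Represents.sum fun j => (S.y_rep j).mul (S.pdx_rep (S.N_rep i k) j))).add
    (Represents.sum fun j => (S.G_rep j).mul (S.Γ_rep i j k)).two_mul).sub
    (Represents.sum fun j => (S.N_rep i j).mul (S.N_rep j k))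

lemma Riem4_rep (i j k l : Fin n) :
    Represents (Riem4 F i j k l) (S.alg.Y j (S.alg.P k l i)) := by
  have h : Represents (Riem4 F i j k l) _ :=
    (S.pdy_rep ((S.pdy_rep (S.RiemK_rep i k) l).sub (S.pdy_rep (S.RiemK_rep i l) k)) j).const_mul
      (1 / 3)
  have e : (3 : smoothAlgebra hF.slit) * S.alg.P k l i = (3 : ℝ) • S.alg.P k l i := by
    rw [Algebra.smul_def, map_ofNat]
  rw [SprayAlgebra.Y_R_sub, e, Derivation.map_smul, smul_smul] at h
  norm_num at h
  exact h

lemma Y_Y_P (hR : RQuadratic U F) (m j k l i : Fin n) :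
    S.alg.Y m (S.alg.Y j (S.alg.P k l i)) = 0 := by
  refine ext_ev fun p => ?_
  rw [← S.pdy_rep (S.Riem4_rep i j k l) m p, map_zero]
  have : (fun y' => Riem4 F i j k l p.1.1 y') =ᶠ[nhds p.1.2]
      fun _ => Riem4 F i j k l p.1.1 p.1.2 := by
    filter_upwards [isOpen_ne.mem_nhds p.2.2] with y' hy'
    exact hR _ p.2.1 _ _ hy' p.2.2 i j k l
  rw [pdy, this.fderiv_eq]
  simp

end SprayModel

end Finsler

/-- **Corollary.** Every R-quadratic Finsler metric is a stretch metric. -/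
theorem rQuadratic_is_stretch {n : ℕ} (U : Set (Pt n)) (F : Pt n → Pt n → ℝ)
    (hF : IsFinslerMetric U F) (hR : RQuadratic U F) :
    ∀ x ∈ U, ∀ y : Pt n, y ≠ 0 → ∀ i j k l : Fin n, Stretch F i j k l x y = 0 := by
  intro x hx y hy i j k l
  obtain ⟨S⟩ := hF.exists_sprayModel
  have h (k l : Fin n) := S.hD3_rep S.Land_rep i j k l ⟨(x, y), hx, hy⟩
  have e := S.alg.hD_L_symm (fun i j l k r => S.Y_Y_P hR i j l k r) i j k l
  simp only [SprayAlgebra.hD_smul] at h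
  rw [Stretch, h k l, h l k, e, sub_self, mul_zero]
end
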